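/- Let c > 1 be an odd integer and let a be any integer. Then there exists an N such that for all n > N, v(a,c;2n) ≤ v(a,c;n−1)·v(a,c;n+1) < √n · p̄(n−1)·p̄(n+1). -/

import Mathlib

open Complex Real Filter Topology

noncomputable section

/-- An odd-balanced unimodal sequence, encoded as (left list `L`, peak `p`, right list `R`):
all parts positive, the peak `p` is even and strictly larger than all other parts,
the left side is weakly increasing and the right side weakly decreasing, repeated
(i.e. equal consecutive) parts are allowed only when they are odd, and the odd parts
before the peak are identical to the odd parts after the peak. -/
def IsOddBalanced (L : List ℕ) (p : ℕ) (R : List ℕ) : Prop :=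
  Even p ∧ 0 < p ∧ (∀ x ∈ L, 0 < x) ∧ (∀ x ∈ R, 0 < x) ∧
  L.Chain' (fun a b => a ≤ b ∧ (a = b → Odd a)) ∧
  R.Chain' (fun a b => b ≤ a ∧ (a = b → Odd a)) ∧
  (∀ x ∈ L, x < p) ∧ (∀ x ∈ R, x < p) ∧
  L.filter (fun x => x % 2 == 1) = R.reverse.filter (fun x => x % 2 == 1)

/-- `v(m,n)`: number of odd-balanced unimodal sequences of size `2n+2` and rank `m`. -/
def oddBalancedCount (m : ℤ) (n : ℕ) : ℕ :=
  Nat.card {x : List ℕ × ℕ × List ℕ //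
    IsOddBalanced x.1 x.2.1 x.2.2 ∧ x.1.sum + x.2.1 + x.2.2.sum = 2 * n + 2 ∧
    (x.2.2.length : ℤ) - (x.1.length : ℤ) = m}

/-- `v(a,c;n)`: number of odd-balanced unimodal sequences of size `2n+2`
whose rank is congruent to `a` modulo `c`. -/
def oddBalancedCountMod (a : ℤ) (c : ℕ) (n : ℕ) : ℕ :=
  Nat.card {x : List ℕ × ℕ × List ℕ //
    IsOddBalanced x.1 x.2.1 x.2.2 ∧ x.1.sum + x.2.1 + x.2.2.sum = 2 * n + 2 ∧
    (x.2.2.length : ℤ) - (x.1.length : ℤ) ≡ a [ZMOD (c : ℤ)]}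

/-- `v(n)`: total number of odd-balanced unimodal sequences of size `2n+2`. -/
def oddBalancedTotal (n : ℕ) : ℕ :=
  Nat.card {x : List ℕ × ℕ × List ℕ //
    IsOddBalanced x.1 x.2.1 x.2.2 ∧ x.1.sum + x.2.1 + x.2.2.sum = 2 * n + 2}

/-- Overpartition function `p̄(n)`: each partition of `n` is counted with
multiplicity `2^(number of distinct parts)` (the overlined parts), which matches the
generating function `∏ (1+qⁿ)/(1-qⁿ)`. -/
def overpartition (n : ℕ) : ℕ := ∑ p : n.Partition, 2 ^ p.parts.toFinset.card



/-! ### Power series -/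
open PowerSeries in
/-- the geometric series `1/(1-X^i)` -/
def geoS (i : ℕ) : PowerSeries ℤ := PowerSeries.mk fun k => if i ∣ k then 1 else 0

open PowerSeries in
lemma geoS_mul (i : ℕ) (hi : 0 < i) : geoS i * (1 - X ^ i) = 1 := by
  ext k
  rw [mul_sub, mul_one, map_sub, coeff_mul_X_pow', geoS]
  simp only [coeff_mk, coeff_one]
  by_cases h : i ≤ k
  · have : i ∣ k - i ↔ i ∣ k := (Nat.dvd_sub_iff_left h (dvd_refl i))
    have hk : k ≠ 0 := by omega
    simp [h, this, hk]
  · rw [if_neg h]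
    by_cases hk : k = 0
    · simp [hk]
    · have : ¬ i ∣ k := fun h' => h (Nat.le_of_dvd (by omega) h')
      simp [hk, this]

open PowerSeries in
lemma geoS_unique (i : ℕ) (hi : 0 < i) (f : PowerSeries ℤ) (hf : f * (1 - X ^ i) = 1) : f = geoS i := by
  calc f = f * (geoS i * (1 - X ^ i)) := by rw [geoS_mul i hi, mul_one]
    _ = (f * (1 - X ^ i)) * geoS i := by ring
    _ = geoS i := by rw [hf, one_mul]

open PowerSeries in
open scoped PowerSeries.WithPiTopology in
lemma tsum_geoS (i : ℕ) (hi : 0 < i) : ∑' j : ℕ, (X : PowerSeries ℤ) ^ (i * j) = geoS i := by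
  apply geoS_unique i hi
  simp_rw [pow_mul]
  exact WithPiTopology.tsum_pow_mul_one_sub_of_constantCoeff_eq_zero (by simp [hi.ne'])

open PowerSeries in
/-- coefficients of an infinite product are those of the finite products -/
lemma coeff_of_prod (g : ℕ → PowerSeries ℤ) (hg : ∀ i, X ^ (i + 1) ∣ g i - 1) (n M : ℕ) (h : n ≤ M) :
    coeff n (∏ i ∈ Finset.range M, g i) = coeff n (∏ i ∈ Finset.range n, g i) := by
  induction M, h using Nat.le_induction with
  | base => rfl
  | succ M hM ih =>
    rw [Finset.prod_range_succ, ← ih]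
    obtain ⟨u, hu⟩ := hg M
    have : g M = 1 + X ^ (M + 1) * u := by rw [← hu]; ring
    rw [this, mul_add, mul_one, map_add, mul_left_comm, coeff_X_pow_mul', if_neg (by omega), add_zero]

open PowerSeries in
open scoped PowerSeries.WithPiTopology in
lemma coeff_of_hasProd (g : ℕ → PowerSeries ℤ) (G : PowerSeries ℤ) (h : HasProd g G)
    (hg : ∀ i, X ^ (i + 1) ∣ g i - 1) (n M : ℕ) (hn : n ≤ M) :
    coeff n G = coeff n (∏ i ∈ Finset.range M, g i) := by
  have h1 := h.tendsto_prod_nat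
  rw [WithPiTopology.tendsto_iff_coeff_tendsto] at h1
  have h2 := h1 n
  have h3 : Tendsto (fun K => coeff n (∏ i ∈ Finset.range K, g i)) atTop
      (𝓝 (coeff n (∏ i ∈ Finset.range M, g i))) := by
    apply tendsto_atTop_of_eventually_const (i₀ := n)
    intro K hK
    rw [coeff_of_prod g hg n K hK, coeff_of_prod g hg n M hn]
  exact tendsto_nhds_unique h2 h3

open PowerSeries in
lemma geoS_sub_one (i : ℕ) (hi : 0 < i) : X ^ i ∣ geoS i - 1 := by
  refine ⟨geoS i, ?_⟩
  linear_combination geoS_mul i hi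

open PowerSeries in
/-- truncated overpartition series -/
def PS (M : ℕ) : PowerSeries ℤ := ∏ i ∈ Finset.range M, ((1 + X ^ (i + 1)) * geoS (i + 1))

open PowerSeries in
open scoped PowerSeries.WithPiTopology in
lemma coeff_PS (n M : ℕ) (h : n ≤ M) : coeff n (PS M) = (overpartition n : ℤ) := by
  have h0 := Nat.Partition.hasProd_genFun (R := ℤ) (fun _ _ => 2)
  have h1 : ∀ i : ℕ, (1 : PowerSeries ℤ) + ∑' j : ℕ, (C (2 : ℤ)) * (X : PowerSeries ℤ) ^ ((i + 1) * (j + 1))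
      = (1 + X ^ (i + 1)) * geoS (i + 1) := by
    intro i
    have e := tsum_geoS (i + 1) (by omega)
    have hs : Summable fun j : ℕ => (X : PowerSeries ℤ) ^ ((i + 1) * j) := by
      simp_rw [pow_mul]
      exact WithPiTopology.summable_pow_of_constantCoeff_eq_zero (by simp)
    have hs' : Summable fun j : ℕ => (X : PowerSeries ℤ) ^ ((i + 1) * (j + 1)) :=
      (summable_nat_add_iff 1).2 hs
    have e2 := hs.tsum_eq_zero_add
    rw [e] at e2
    have e3 : ∑' j : ℕ, (C (2 : ℤ)) * (X : PowerSeries ℤ) ^ ((i + 1) * (j + 1))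
        = 2 * ∑' j : ℕ, (X : PowerSeries ℤ) ^ ((i + 1) * (j + 1)) := by
      rw [← hs'.tsum_mul_left]
      rfl
    rw [e3]
    simp only [mul_zero, pow_zero] at e2
    linear_combination (-2) * e2 + geoS_mul (i+1) (by omega)
  simp_rw [smul_eq_C_mul, h1] at h0
  rw [PS, ← coeff_of_hasProd _ _ h0 ?_ n M h]
  · rw [Nat.Partition.coeff_genFun, overpartition]
    push_cast
    apply Finset.sum_congr rfl
    intro p _
    rw [Finsupp.prod, Finset.prod_const]
    simp
  · intro i
    obtain ⟨u, hu⟩ := geoS_sub_one (i + 1) (by omega)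
    refine ⟨u + geoS (i + 1), ?_⟩
    linear_combination hu

open PowerSeries in
/-- truncated series of distinct partitions -/
def QS (M : ℕ) : PowerSeries ℤ := ∏ i ∈ Finset.range M, (1 + X ^ (i + 1))

open PowerSeries in
open scoped PowerSeries.WithPiTopology in
lemma coeff_QS (n M : ℕ) (h : n ≤ M) : coeff n (QS M) = ((Nat.Partition.distincts n).card : ℤ) := by
  have h0 := Nat.Partition.hasProd_powerSeriesMk_card_countRestricted ℤ (m := 2) (by norm_num)
  simp only [Finset.sum_range_succ, Finset.sum_range_zero, mul_zero, pow_zero, zero_add, mul_one] at h0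
  rw [QS, ← coeff_of_hasProd _ _ h0 ?_ n M h]
  · rw [coeff_mk, Nat.Partition.countRestricted_two]
  · intro i
    simp

open PowerSeries in
/-- truncated series of odd partitions -/
def OS (M : ℕ) : PowerSeries ℤ := ∏ i ∈ Finset.range M, geoS (2 * i + 1)

open PowerSeries in
open scoped PowerSeries.WithPiTopology in
lemma coeff_OS (n M : ℕ) (h : n ≤ M) : coeff n (OS M) = ((Nat.Partition.odds n).card : ℤ) := by
  have h0 := Nat.Partition.hasProd_powerSeriesMk_card_restricted ℤ (fun i => ¬ Even i)
  have h1 : ∀ i : ℕ, ∑' j : ℕ, (X : PowerSeries ℤ) ^ ((i + 1) * j) = geoS (i + 1) :=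
    fun i => tsum_geoS _ (by omega)
  simp_rw [h1] at h0
  have hd : ∀ i : ℕ, X ^ (i + 1) ∣ (if ¬ Even (i + 1) then geoS (i + 1) else (1 : PowerSeries ℤ)) - 1 := by
    intro i
    split_ifs
    · simp
    · exact geoS_sub_one _ (by omega)
  have h2 := coeff_of_hasProd _ _ h0 hd n (2 * M) (by omega)
  rw [coeff_mk] at h2
  rw [Nat.Partition.odds, h2]
  congr 1
  rw [OS]
  clear h h2
  induction M with
  | zero => rfl
  | succ M ih =>
    rw [Finset.prod_range_succ, ih, mul_add, mul_one, Finset.prod_range_succ, Finset.prod_range_succ]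
    rw [if_pos (by simp), if_neg (by simp [Nat.even_add]), mul_one]

/-! ### Gauss identity following Shanks -/
open PowerSeries in
lemma shanks (n : ℕ) : ∑ s ∈ Finset.range (2 * n), (X : PowerSeries ℤ) ^ (s * (s + 1) / 2)
    = ∑ s ∈ Finset.range n, (∏ i ∈ Finset.Ico s n, (1 - X ^ (2 * i + 2)) * geoS (2 * i + 1)) *
      X ^ (s * (2 * n + 1)) := by
  induction n with
  | zero => simp
  | succ n ih =>
    rw [mul_add, mul_one, Finset.sum_range_succ, Finset.sum_range_succ, ih]
    have t1 : 2 * n * (2 * n + 1) / 2 = n * (2 * n + 1) := by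
      rw [mul_assoc]; exact Nat.mul_div_cancel_left _ (by norm_num)
    have t2 : (2 * n + 1) * (2 * n + 1 + 1) / 2 = (n + 1) * (2 * n + 1) := by
      rw [show (2 * n + 1) * (2 * n + 1 + 1) = 2 * ((n + 1) * (2 * n + 1)) by ring]
      exact Nat.mul_div_cancel_left _ (by norm_num)
    rw [t1, t2]
    set A : ℕ → PowerSeries ℤ := fun s =>
      (∏ i ∈ Finset.Ico s n, (1 - X ^ (2 * i + 2)) * geoS (2 * i + 1)) * X ^ (s * (2 * n + 1)) with hA
    have hAn : A n = X ^ (n * (2 * n + 1)) := by simp [hA]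
    have hstep : ∀ s < n, A (s + 1) * (1 - X ^ (2 * s + 2)) = A s * X ^ (2 * n + 1) * (1 - X ^ (2 * s + 1)) := by
      intro s hs
      simp only [hA]
      rw [Finset.prod_eq_prod_Ico_succ_bot hs]
      rw [show (s + 1) * (2 * n + 1) = s * (2 * n + 1) + (2 * n + 1) by ring, pow_add]
      have := geoS_mul (2 * s + 1) (by omega)
      linear_combination (-(∏ i ∈ Finset.Ico (s + 1) n, (1 - X ^ (2 * i + 2)) * geoS (2 * i + 1)) *
        (X ^ (s * (2 * n + 1)) * X ^ (2 * n + 1)) * (1 - X ^ (2 * s + 2))) * this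
    have hnew : ∀ s ∈ Finset.range (n + 1), (∏ i ∈ Finset.Ico s (n + 1), (1 - X ^ (2 * i + 2)) * geoS (2 * i + 1)) *
        X ^ (s * (2 * (n + 1) + 1)) = A s * ((1 - X ^ (2 * n + 2)) * geoS (2 * n + 1)) * X ^ (2 * s) := by
      intro s hs
      rw [Finset.mem_range] at hs
      rw [Finset.prod_Ico_succ_top (by omega)]
      simp only [hA]
      rw [show s * (2 * (n + 1) + 1) = s * (2 * n + 1) + 2 * s by ring, pow_add]
      ring
    rw [show 2 * n + 2 + 1 = 2 * (n + 1) + 1 by ring, Finset.sum_congr rfl hnew, ← hAn, ← Finset.sum_range_succ (f := A)]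
    -- telescoping
    have key : ∀ m ≤ n, (∑ s ∈ Finset.range m, A s * (X ^ (2 * s) * (1 - X ^ (2 * n + 2)) - (1 - X ^ (2 * n + 1))))
        = A m * (1 - X ^ (2 * m)) := by
      intro m
      induction m with
      | zero => simp
      | succ m ihm =>
        intro hm
        rw [Finset.sum_range_succ, ihm (by omega)]
        have := hstep m (by omega)
        rw [show 2 * (m + 1) = 2 * m + 2 by ring]
        linear_combination (-1) * this
    have g := geoS_mul (2 * n + 1) (by omega)
    have k2 := key n le_rfl
    have hsum : ∑ s ∈ Finset.range (n + 1), A s * ((1 - X ^ (2 * n + 2)) * geoS (2 * n + 1)) * X ^ (2 * s)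
        - ∑ s ∈ Finset.range (n + 1), A s = geoS (2 * n + 1) *
        ∑ s ∈ Finset.range (n + 1), A s * (X ^ (2 * s) * (1 - X ^ (2 * n + 2)) - (1 - X ^ (2 * n + 1))) := by
      rw [← Finset.sum_sub_distrib, Finset.mul_sum]
      apply Finset.sum_congr rfl
      intro s _
      linear_combination (A s) * g
    rw [Finset.sum_range_succ (f := fun s => A s * (X ^ (2 * s) * (1 - X ^ (2 * n + 2)) - (1 - X ^ (2 * n + 1)))), k2] at hsum
    have e : (X : PowerSeries ℤ) ^ ((n + 1) * (2 * n + 1)) = A n * X ^ (2 * n + 1) := by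
      rw [hAn, ← pow_add]; congr 1; ring
    rw [e]
    linear_combination (-1) * hsum - (A n * X ^ (2 * n + 1)) * g


open PowerSeries in
lemma gauss_trunc (M : ℕ) (hM : 0 < M) : X ^ (M + 1) ∣ PS M * (∑ s ∈ Finset.range (2 * M), (X : PowerSeries ℤ) ^ (s * (s + 1) / 2))
    - QS M * QS M * OS M := by
  have h1 : PS M * ∏ i ∈ Finset.range M, (1 - X ^ (i + 1)) = QS M := by
    rw [PS, QS, ← Finset.prod_mul_distrib]
    apply Finset.prod_congr rfl
    intro i _
    rw [mul_assoc, geoS_mul _ (by omega), mul_one]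
  have h2 : ∏ i ∈ Finset.range M, ((1 - X ^ (2 * i + 2)) * geoS (2 * i + 1)) =
      (∏ i ∈ Finset.range M, (1 - X ^ (i + 1))) * QS M * OS M := by
    rw [QS, OS, ← Finset.prod_mul_distrib, ← Finset.prod_mul_distrib]
    apply Finset.prod_congr rfl
    intro i _
    rw [show 2 * i + 2 = (i + 1) * 2 by ring, pow_mul]
    ring
  rw [shanks]
  rw [Finset.range_eq_Ico, Finset.sum_eq_sum_Ico_succ_bot hM, ← Finset.range_eq_Ico, h2]
  have h3 : X ^ (M + 1) ∣ ∑ s ∈ Finset.Ico (0 + 1) M,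
      (∏ i ∈ Finset.Ico s M, (1 - X ^ (2 * i + 2)) * geoS (2 * i + 1)) * X ^ (s * (2 * M + 1)) := by
    apply Finset.dvd_sum
    intro s hs
    rw [Finset.mem_Ico] at hs
    apply Dvd.dvd.mul_left
    apply pow_dvd_pow
    nlinarith
  obtain ⟨u, hu⟩ := h3
  rw [hu]
  refine ⟨PS M * u, ?_⟩
  simp only [zero_mul, pow_zero, mul_one]
  linear_combination (QS M * OS M) * h1

/-- number of triples -/
def tt (m : ℕ) : ℕ := ∑ s ∈ Finset.range (m + 1), if s * (s + 1) / 2 ≤ m then overpartition (m - s * (s + 1) / 2) else 0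

open PowerSeries in
lemma coeff_tt (m M : ℕ) (h : m < M) : coeff m (QS M * QS M * OS M) = (tt m : ℤ) := by
  obtain ⟨u, hu⟩ := gauss_trunc M (by omega)
  have h1 : QS M * QS M * OS M = PS M * (∑ s ∈ Finset.range (2 * M), (X : PowerSeries ℤ) ^ (s * (s + 1) / 2))
    - X ^ (M + 1) * u := by rw [← hu]; ring
  rw [h1, map_sub, coeff_X_pow_mul', if_neg (by omega), sub_zero, Finset.mul_sum, map_sum, tt]
  push_cast
  symm
  have hsub : Finset.range (m + 1) ⊆ Finset.range (2 * M) := by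
    intro x; simp only [Finset.mem_range]; omega
  rw [← Finset.sum_subset hsub]
  · apply Finset.sum_congr rfl
    intro s _
    rw [coeff_mul_X_pow']
    split_ifs with h2
    · rw [coeff_PS _ _ (by omega)]
    · rfl
  · intro s _ hs
    simp only [Finset.mem_range, not_lt] at hs
    rw [coeff_mul_X_pow', if_neg]
    intro h3
    have : s * 2 ≤ s * (s + 1) := Nat.mul_le_mul_left _ (by omega)
    omega

/-! ### logarithmic derivative -/
open PowerSeries in
def BS (M : ℕ) : PowerSeries ℤ := ∑ i ∈ Finset.range M, (2 * ((i : PowerSeries ℤ) + 1)) * X ^ (i + 1) * geoS (2 * (i + 1))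

open PowerSeries in
lemma logDer (M : ℕ) : X * d⁄dX ℤ (PS M) = PS M * BS M := by
  induction M with
  | zero => simp [PS, BS]
  | succ M ih =>
    have e1 : PS (M + 1) = PS M * ((1 + X ^ (M + 1)) * geoS (M + 1)) := Finset.prod_range_succ _ _
    have e2 : BS (M + 1) = BS M + (2 * ((M : PowerSeries ℤ) + 1)) * X ^ (M + 1) * geoS (2 * (M + 1)) := Finset.sum_range_succ _ _
    have hg := geoS_mul (M + 1) (by omega)
    have hg2 : (1 + X ^ (M + 1)) * geoS (2 * (M + 1)) = geoS (M + 1) := by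
      apply geoS_unique _ (by omega)
      have := geoS_mul (2 * (M + 1)) (by omega)
      rw [show 2 * (M + 1) = (M + 1) * 2 by ring, pow_mul] at this
      rw [show 2 * (M + 1) = (M + 1) * 2 by ring]
      linear_combination this
    have hY : X * d⁄dX ℤ ((X : PowerSeries ℤ) ^ (M + 1)) = ((M : PowerSeries ℤ) + 1) * X ^ (M + 1) := by
      rw [Derivation.leibniz_pow]
      simp [derivative_X]
      ring
    have hdg : X * d⁄dX ℤ (geoS (M + 1)) = ((M : PowerSeries ℤ) + 1) * X ^ (M + 1) * geoS (M + 1) ^ 2 := by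
      have := congrArg (fun f => X * d⁄dX ℤ f) hg
      simp only [Derivation.leibniz, map_sub, Derivation.map_one_eq_zero, smul_eq_mul, mul_zero] at this
      linear_combination (geoS (M + 1)) * this + geoS (M + 1) ^ 2 * hY - (X * d⁄dX ℤ (geoS (M + 1))) * hg
    rw [e1, e2]
    simp only [Derivation.leibniz, map_add, Derivation.map_one_eq_zero, smul_eq_mul, zero_add]
    generalize geoS (M + 1) = g at *
    generalize geoS (2 * (M + 1)) = g2 at *
    generalize d⁄dX ℤ (PS M) = dP at *
    generalize d⁄dX ℤ ((X : PowerSeries ℤ) ^ (M + 1)) = dY at *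
    generalize d⁄dX ℤ g = dg at *
    generalize (X : PowerSeries ℤ) ^ (M + 1) = Y at *
    generalize (M : PowerSeries ℤ) + 1 = c at *
    linear_combination ((1 + Y) * g) * ih + PS M * g * hY + PS M * (1 + Y) * hdg - (PS M * g * 2 * c * Y) * hg2
      - (PS M * c * Y * g) * hg

open PowerSeries in
def NN (f : PowerSeries ℤ) : Prop := ∀ n, 0 ≤ coeff n f

open PowerSeries in
lemma NN.mul {f g : PowerSeries ℤ} (hf : NN f) (hg : NN g) : NN (f * g) := by
  intro n
  rw [coeff_mul]
  exact Finset.sum_nonneg fun i _ => mul_nonneg (hf _) (hg _)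

open PowerSeries in
lemma NN.one_add (i : ℕ) : NN (1 + X ^ i) := by
  intro n
  rw [map_add, coeff_one, coeff_X_pow]
  split_ifs <;> norm_num

open PowerSeries in
lemma NN.geo (i : ℕ) : NN (geoS i) := by
  intro n
  rw [geoS, coeff_mk]
  split_ifs <;> norm_num

lemma NN.one : NN 1 := by
  intro n
  rw [PowerSeries.coeff_one]
  split_ifs <;> norm_num

lemma NN.prod (s : Finset ℕ) (f : ℕ → PowerSeries ℤ) (h : ∀ i ∈ s, NN (f i)) : NN (∏ i ∈ s, f i) := by
  classical
  induction s using Finset.induction_on with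
  | empty => simpa using NN.one
  | insert a s ha ih =>
    rw [Finset.prod_insert ha]
    exact NN.mul (h a (by simp)) (ih fun i hi => h i (by simp [hi]))

open PowerSeries in
lemma NN_E (M : ℕ) : NN ((1 - X) ^ 2 * PS (M + 2)) := by
  have e : (1 - X) ^ 2 * PS (M + 2) = (1 + X ^ 2) * ∏ i ∈ Finset.range M, ((1 + X ^ (i + 2 + 1)) * geoS (i + 2 + 1)) := by
    have h1 := geoS_mul 1 (by omega)
    have h2 := geoS_mul 2 (by omega)
    rw [PS, add_comm M 2, Finset.prod_range_add]
    simp only [Finset.prod_range_succ, Finset.prod_range_zero]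
    have : ∀ i, 2 + i = i + 2 := fun i => add_comm _ _
    simp only [this]
    generalize (∏ i ∈ Finset.range M, ((1 + X ^ (i + 2 + 1)) * geoS (i + 2 + 1))) = Z
    norm_num at *
    linear_combination ((1 - X) * (1 + X) * geoS 2 * (1 + X ^ 2) * Z) * h1 + ((1 + X ^ 2) * Z) * h2
  rw [e]
  exact (NN.one_add 2).mul (NN.prod _ _ fun i _ => (NN.one_add _).mul (NN.geo _))

open PowerSeries in
lemma NN_d (M : ℕ) : NN ((1 - X) * PS (M + 2)) := by
  have h1 := geoS_mul 1 (by omega)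
  have : (1 - X) * PS (M + 2) = ((1 - X) ^ 2 * PS (M + 2)) * geoS 1 := by
    rw [pow_one] at h1
    linear_combination (-(1 - X) * PS (M + 2)) * h1
  rw [this]
  exact (NN_E M).mul (NN.geo 1)

open PowerSeries in
lemma coeff_mul_geo (f : PowerSeries ℤ) (n : ℕ) : coeff n (f * geoS 1) = ∑ i ∈ Finset.range (n + 1), coeff i f := by
  rw [coeff_mul, Finset.Nat.sum_antidiagonal_eq_sum_range_succ_mk]
  simp [geoS]

open PowerSeries in
lemma H_bound (i : ℕ) (hi : 0 < i) (k : ℕ) :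
    (k < i → coeff k (X ^ i * geoS (2 * i) * geoS 1) = 0) ∧
    (i ≤ k → 2 * (i : ℤ) * coeff k (X ^ i * geoS (2 * i) * geoS 1) ≤ k + i) := by
  have h0 : ∀ k, k < i → coeff k (X ^ i * geoS (2 * i) * geoS 1) = 0 := by
    intro k hk
    rw [mul_assoc, coeff_X_pow_mul', if_neg (by omega)]
  refine ⟨h0 k, ?_⟩
  have hrec : ∀ k, i ≤ k → coeff k (X ^ i * geoS (2 * i) * geoS 1) =
      (if 2 * i ≤ k then coeff (k - 2 * i) (X ^ i * geoS (2 * i) * geoS 1) else 0) + 1 := by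
    intro k hk
    have : X ^ i * geoS (2 * i) * geoS 1 = (X ^ i * geoS (2 * i) * geoS 1) * X ^ (2 * i) + X ^ i * geoS 1 := by
      linear_combination (X ^ i * geoS 1) * geoS_mul (2 * i) (by omega)
    conv_lhs => rw [this]
    rw [map_add, coeff_mul_X_pow', coeff_X_pow_mul', if_pos hk]
    simp [geoS]
  induction k using Nat.strong_induction_on with
  | _ k ih =>
    intro hk
    rw [hrec k hk]
    split_ifs with h
    · by_cases h2 : i ≤ k - 2 * i
      · have := ih (k - 2 * i) (by omega) h2
        push_cast [h] at this
        linarith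
      · rw [h0 _ (by omega)]
        push_cast
        have : (i : ℤ) ≤ k := by exact_mod_cast hk
        linarith
    · have : (i : ℤ) ≤ k := by exact_mod_cast hk
      linarith

open PowerSeries in
lemma BS_upper (M j : ℕ) : 2 * coeff j (BS M * geoS 1) ≤ 3 * ((j : ℤ) * (j + 1)) := by
  have h1 : coeff j (BS M * geoS 1) = ∑ i ∈ Finset.range M, 2 * ((i + 1 : ℕ) : ℤ) * coeff j (X ^ (i + 1) * geoS (2 * (i + 1)) * geoS 1) := by
    rw [BS, Finset.sum_mul, map_sum]
    apply Finset.sum_congr rfl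
    intro i _
    have : (2 * ((i : PowerSeries ℤ) + 1)) * X ^ (i + 1) * geoS (2 * (i + 1)) * geoS 1 =
      C (2 * ((i + 1 : ℕ) : ℤ)) * (X ^ (i + 1) * geoS (2 * (i + 1)) * geoS 1) := by
      rw [map_mul, map_natCast]; push_cast; rw [show (C (2 : ℤ) : PowerSeries ℤ) = 2 from rfl]; ring
    rw [this, coeff_C_mul]
  have h2 : coeff j (BS M * geoS 1) ≤ ∑ i ∈ Finset.range M, if i < j then (j : ℤ) + i + 1 else 0 := by
    rw [h1]
    apply Finset.sum_le_sum
    intro i _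
    have := H_bound (i + 1) (by omega) j
    split_ifs with h
    · have := this.2 (by omega)
      push_cast at *; linarith
    · rw [this.1 (by omega), mul_zero]
  have h3 : ∑ i ∈ Finset.range M, (if i < j then (j : ℤ) + i + 1 else 0) ≤ ∑ i ∈ Finset.range j, ((j : ℤ) + i + 1) := by
    rw [← Finset.sum_filter]
    apply Finset.sum_le_sum_of_subset_of_nonneg
    · intro i; simp only [Finset.mem_filter, Finset.mem_range]; tauto
    · intros; positivity
  have h4 : ∀ n : ℕ, 2 * ∑ i ∈ Finset.range n, ((j : ℤ) + i + 1) = 2 * n * j + n * (n + 1) := by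
    intro n
    induction n with
    | zero => simp
    | succ n ih => rw [Finset.sum_range_succ, mul_add, ih]; push_cast; ring
  have := h4 j
  nlinarith

open PowerSeries in
lemma BS_lower (M j : ℕ) (h : j ≤ M) : 2 * (j : ℤ) ≤ coeff j (BS M) := by
  rcases Nat.eq_zero_or_pos j with rfl | hj
  · rw [BS, map_sum]; push_cast
    apply Finset.sum_nonneg
    intro i _
    rw [mul_right_comm, coeff_mul_X_pow', if_neg (by omega)]
  have h1 : ∀ i : ℕ, coeff j ((2 * ((i : PowerSeries ℤ) + 1)) * X ^ (i + 1) * geoS (2 * (i + 1))) =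
     2 * ((i + 1 : ℕ) : ℤ) * coeff j (X ^ (i + 1) * geoS (2 * (i + 1))) := by
    intro i
    have : (2 * ((i : PowerSeries ℤ) + 1)) * X ^ (i + 1) * geoS (2 * (i + 1)) =
      C (2 * ((i + 1 : ℕ) : ℤ)) * (X ^ (i + 1) * geoS (2 * (i + 1))) := by
      rw [map_mul, map_natCast]; push_cast; rw [show (C (2 : ℤ) : PowerSeries ℤ) = 2 from rfl]; ring
    rw [this, coeff_C_mul]
  rw [BS, map_sum]
  have h2 : 2 * (j : ℤ) = coeff j ((2 * (((j - 1 : ℕ) : PowerSeries ℤ) + 1)) * X ^ ((j - 1) + 1) * geoS (2 * ((j - 1) + 1))) := by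
    rw [h1, show j - 1 + 1 = j by omega, coeff_X_pow_mul', if_pos le_rfl]
    simp [geoS]
  rw [h2]
  apply Finset.single_le_sum (f := fun i : ℕ => coeff j ((2 * ((i : PowerSeries ℤ) + 1)) * X ^ (i + 1) * geoS (2 * (i + 1))))
  · intro i _
    rw [h1]
    apply mul_nonneg (by positivity)
    rw [coeff_X_pow_mul']
    split_ifs
    · exact NN.geo _ _
    · exact le_rfl
  · simp; omega

open PowerSeries in
lemma K1 : (PowerSeries.mk fun j : ℕ => (2 : ℤ) * j) = 2 * X * geoS 1 ^ 2 := by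
  have h : (PowerSeries.mk fun j : ℕ => (2 : ℤ) * j) * (1 - X) = 2 * X * geoS 1 := by
    ext n
    rw [mul_sub, mul_one, map_sub, mul_assoc, mul_comm X, show (2 : PowerSeries ℤ) = C (2 : ℤ) from rfl, coeff_C_mul]
    cases n with
    | zero => simp
    | succ n => rw [coeff_succ_mul_X, coeff_succ_mul_X]; simp [geoS]; ring
  have g := geoS_mul 1 (by omega)
  rw [pow_one] at g
  linear_combination (geoS 1) * h - (PowerSeries.mk fun j : ℕ => (2 : ℤ) * j) * g

open PowerSeries in
lemma K2 : (PowerSeries.mk fun j : ℕ => (j : ℤ) * (j + 1)) = 2 * X * geoS 1 ^ 3 := by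
  have h : (PowerSeries.mk fun j : ℕ => (j : ℤ) * (j + 1)) * (1 - X) = (PowerSeries.mk fun j : ℕ => (2 : ℤ) * j) := by
    ext n
    rw [mul_sub, mul_one, map_sub]
    cases n with
    | zero => simp
    | succ n => rw [coeff_succ_mul_X]; simp; ring
  rw [K1] at h
  have g := geoS_mul 1 (by omega)
  rw [pow_one] at g
  linear_combination (geoS 1) * h - (PowerSeries.mk fun j : ℕ => (j : ℤ) * (j + 1)) * g

/-- partial sums of the overpartition function -/
def SS (n : ℕ) : ℕ := ∑ i ∈ Finset.range (n + 1), overpartition i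

open PowerSeries in
lemma coeff_PSgeo (M n : ℕ) (h : n ≤ M) : coeff (n + 1) (2 * X * PS M * geoS 1) = 2 * (SS n : ℤ) := by
  rw [show 2 * X * PS M * geoS 1 = C (2 : ℤ) * ((PS M * geoS 1) * X) by
    rw [show (2 : PowerSeries ℤ) = C (2 : ℤ) from rfl]; ring]
  rw [coeff_C_mul, coeff_succ_mul_X, coeff_mul_geo, SS]
  push_cast
  congr 1
  apply Finset.sum_congr rfl
  intro i hi
  rw [Finset.mem_range] at hi
  rw [coeff_PS _ _ (by omega)]

open PowerSeries in
lemma coeff_lhs (M n : ℕ) (h : n + 1 ≤ M) : coeff (n + 1) ((1 - X) * (X * d⁄dX ℤ (PS M))) =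
    (n + 1) * (overpartition (n + 1) : ℤ) - n * overpartition n := by
  rw [sub_mul, one_mul, map_sub, coeff_succ_X_mul, coeff_succ_X_mul, coeff_derivative, coeff_PS _ _ h]
  cases n with
  | zero => simp
  | succ n => rw [coeff_succ_X_mul, coeff_derivative, coeff_PS _ _ (by omega)]; push_cast; ring

open PowerSeries in
lemma over_upper (n : ℕ) : (n + 1) * (overpartition (n + 1) : ℤ) - n * overpartition n ≤ 3 * SS n := by
  have h1 := coeff_lhs (n + 2) n (by omega)
  have g := geoS_mul 1 (by omega)
  rw [pow_one] at g
  have e : (1 - X) * (X * d⁄dX ℤ (PS (n + 2))) = ((1 - X) ^ 2 * PS (n + 2)) * (BS (n + 2) * geoS 1) := by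
    rw [logDer]
    linear_combination (-(1 - X) * PS (n + 2) * BS (n + 2)) * g
  have e2 : ((1 - X) ^ 2 * PS (n + 2)) * (PowerSeries.mk fun j : ℕ => (j : ℤ) * (j + 1)) = 2 * X * PS (n + 2) * geoS 1 := by
    rw [K2]
    linear_combination (2 * X * PS (n + 2) * geoS 1) * (geoS 1 * (1 - X) + 1) * g
  have h2 := coeff_PSgeo (n + 2) n (by omega)
  rw [← e2, coeff_mul] at h2
  rw [e, coeff_mul] at h1
  rw [← h1]
  have : 2 * ∑ p ∈ Finset.HasAntidiagonal.antidiagonal (n + 1), coeff p.1 ((1 - X) ^ 2 * PS (n + 2)) * coeff p.2 (BS (n + 2) * geoS 1)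
     ≤ 3 * ∑ p ∈ Finset.HasAntidiagonal.antidiagonal (n + 1), coeff p.1 ((1 - X) ^ 2 * PS (n + 2)) * coeff p.2 (PowerSeries.mk fun j : ℕ => (j : ℤ) * (j + 1)) := by
    rw [Finset.mul_sum, Finset.mul_sum]
    apply Finset.sum_le_sum
    intro p _
    have a := NN_E n p.1
    have b := BS_upper (n + 2) p.2
    rw [coeff_mk]
    nlinarith
  rw [h2] at this
  linarith

open PowerSeries in
lemma over_lower (n : ℕ) : 2 * (SS n : ℤ) ≤ (n + 1) * (overpartition (n + 1) : ℤ) - n * overpartition n := by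
  have h1 := coeff_lhs (n + 2) n (by omega)
  have g := geoS_mul 1 (by omega)
  rw [pow_one] at g
  have e : (1 - X) * (X * d⁄dX ℤ (PS (n + 2))) = ((1 - X) * PS (n + 2)) * BS (n + 2) := by
    rw [logDer]; ring
  have e2 : ((1 - X) * PS (n + 2)) * (PowerSeries.mk fun j : ℕ => (2 : ℤ) * j) = 2 * X * PS (n + 2) * geoS 1 := by
    rw [K1]
    linear_combination (2 * X * PS (n + 2) * geoS 1) * g
  have h2 := coeff_PSgeo (n + 2) n (by omega)
  rw [← e2, coeff_mul] at h2
  rw [e, coeff_mul] at h1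
  rw [← h1, ← h2]
  apply Finset.sum_le_sum
  intro p hp
  rw [Finset.HasAntidiagonal.mem_antidiagonal] at hp
  rw [coeff_mk]
  exact mul_le_mul_of_nonneg_left (BS_lower _ _ (by omega)) (NN_d n _)

open PowerSeries in
lemma over_mono : Monotone overpartition := by
  apply monotone_nat_of_le_succ
  intro n
  have := NN_d n (n + 1)
  rw [sub_mul, one_mul, map_sub, coeff_succ_X_mul, coeff_PS _ _ (by omega), coeff_PS _ _ (by omega)] at this
  exact_mod_cast (by linarith : (overpartition n : ℤ) ≤ overpartition (n + 1))

open PowerSeries in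
lemma over_pos (n : ℕ) : 0 < overpartition n := by
  refine lt_of_lt_of_le ?_ (over_mono (Nat.zero_le n))
  have := coeff_PS 0 0 le_rfl
  simp [PS] at this
  omega


/-! ### Combinatorial model -/

def DF (i : ℕ) : Finset (Multiset ℕ) := (Nat.Partition.distincts i).image Nat.Partition.parts
def OF (i : ℕ) : Finset (Multiset ℕ) := (Nat.Partition.odds i).image Nat.Partition.parts

lemma parts_inj (i : ℕ) : Function.Injective (Nat.Partition.parts (n := i)) := fun _ _ h => Nat.Partition.ext h

lemma mem_DF (i : ℕ) (s : Multiset ℕ) : s ∈ DF i ↔ s.Nodup ∧ (∀ x ∈ s, 0 < x) ∧ s.sum = i := by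
  simp only [DF, Finset.mem_image, Nat.Partition.distincts, Finset.mem_filter, Finset.mem_univ, true_and]
  constructor
  · rintro ⟨p, hp, rfl⟩
    exact ⟨hp, fun x hx => p.parts_pos hx, p.parts_sum⟩
  · rintro ⟨h1, h2, h3⟩
    exact ⟨⟨s, fun hx => h2 _ hx, h3⟩, h1, rfl⟩

lemma mem_OF (i : ℕ) (s : Multiset ℕ) : s ∈ OF i ↔ (∀ x ∈ s, Odd x) ∧ s.sum = i := by
  simp only [OF, Finset.mem_image, Nat.Partition.odds, Nat.Partition.restricted, Finset.mem_filter,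
    Finset.mem_univ, true_and, Nat.not_even_iff_odd]
  constructor
  · rintro ⟨p, hp, rfl⟩
    exact ⟨hp, p.parts_sum⟩
  · rintro ⟨h1, h3⟩
    exact ⟨⟨s, fun hx => (h1 _ hx).pos, h3⟩, h1, rfl⟩

lemma card_DF (i : ℕ) : (DF i).card = (Nat.Partition.distincts i).card :=
  Finset.card_image_of_injective _ (parts_inj i)
lemma card_OF (i : ℕ) : (OF i).card = (Nat.Partition.odds i).card :=
  Finset.card_image_of_injective _ (parts_inj i)

def gprod {α β : Type*} [DecidableEq α] [DecidableEq β] (F : ℕ → Finset α) (G : ℕ → Finset β) (n : ℕ) :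
    Finset (α × β) :=
  (Finset.HasAntidiagonal.antidiagonal n).biUnion fun p => F p.1 ×ˢ G p.2

lemma card_gprod {α β : Type*} [DecidableEq α] [DecidableEq β] (F : ℕ → Finset α) (G : ℕ → Finset β) (n : ℕ)
    (wa : α → ℕ) (wb : β → ℕ) (ha : ∀ n, ∀ x ∈ F n, wa x = n) (hb : ∀ n, ∀ x ∈ G n, wb x = n) :
    (gprod F G n).card = ∑ p ∈ Finset.HasAntidiagonal.antidiagonal n, (F p.1).card * (G p.2).card := by
  rw [gprod, Finset.card_biUnion]
  · simp [Finset.card_product]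
  · intro p _ q _ hpq
    rw [Function.onFun, Finset.disjoint_left]
    rintro ⟨x, y⟩ h1 h2
    rw [Finset.mem_product] at h1 h2
    apply hpq
    ext
    · rw [← ha _ _ h1.1, ← ha _ _ h2.1]
    · rw [← hb _ _ h1.2, ← hb _ _ h2.2]

lemma mem_gprod {α β : Type*} [DecidableEq α] [DecidableEq β] (F : ℕ → Finset α) (G : ℕ → Finset β) (n : ℕ)
    (x : α × β) : x ∈ gprod F G n ↔ ∃ i j, i + j = n ∧ x.1 ∈ F i ∧ x.2 ∈ G j := by
  simp only [gprod, Finset.mem_biUnion, Finset.mem_product, Finset.HasAntidiagonal.mem_antidiagonal, Prod.exists]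

def TF (m : ℕ) : Finset (Multiset ℕ × Multiset ℕ × Multiset ℕ) := gprod DF (gprod DF OF) m

lemma mem_TF (m : ℕ) (x : Multiset ℕ × Multiset ℕ × Multiset ℕ) : x ∈ TF m ↔
    x.1.Nodup ∧ (∀ y ∈ x.1, 0 < y) ∧ x.2.1.Nodup ∧ (∀ y ∈ x.2.1, 0 < y) ∧ (∀ y ∈ x.2.2, Odd y) ∧
    x.1.sum + x.2.1.sum + x.2.2.sum = m := by
  simp only [TF, mem_gprod, mem_DF, mem_OF]
  constructor
  · rintro ⟨i, j, rfl, ⟨h1, h2, rfl⟩, k, l, rfl, ⟨h3, h4, rfl⟩, h5, rfl⟩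
    exact ⟨h1, h2, h3, h4, h5, by ring⟩
  · rintro ⟨h1, h2, h3, h4, h5, h6⟩
    exact ⟨_, _, by rw [← h6, add_assoc], ⟨h1, h2, rfl⟩, _, _, rfl, ⟨h3, h4, rfl⟩, h5, rfl⟩

open PowerSeries in
lemma card_TF (m : ℕ) : (TF m).card = tt m := by
  have hO : ∀ n, ∀ x ∈ OF n, Multiset.sum x = n := fun n x hx => ((mem_OF n x).1 hx).2
  have hD : ∀ n, ∀ x ∈ DF n, Multiset.sum x = n := fun n x hx => ((mem_DF n x).1 hx).2.2
  have hDO : ∀ n, ∀ x ∈ gprod DF OF n, x.1.sum + x.2.sum = n := by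
    intro n x hx
    rw [mem_gprod] at hx
    obtain ⟨i, j, rfl, h1, h2⟩ := hx
    rw [hD _ _ h1, hO _ _ h2]
  have h := coeff_tt m (m + 1) (by omega)
  rw [mul_assoc, coeff_mul] at h
  have : ((TF m).card : ℤ) = tt m := by
    rw [← h, TF, card_gprod _ _ _ _ _ hD hDO]
    push_cast
    apply Finset.sum_congr rfl
    intro p hp
    rw [Finset.HasAntidiagonal.mem_antidiagonal] at hp
    rw [card_gprod _ _ _ _ _ hD hO, coeff_QS _ _ (by omega), card_DF, coeff_mul]
    push_cast
    congr 1
    apply Finset.sum_congr rfl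
    intro q hq
    rw [Finset.HasAntidiagonal.mem_antidiagonal] at hq
    rw [coeff_QS _ _ (by omega), coeff_OS _ _ (by omega), card_DF, card_OF]
  exact_mod_cast this

/-! ### Upper bound -/

/-- halves of the even parts of a list -/
def evh (L : List ℕ) : Multiset ℕ := ((L : Multiset ℕ).filter (fun x => x % 2 = 0)).map (fun x => x / 2)
/-- odd parts of a list -/
def odp (L : List ℕ) : Multiset ℕ := (L : Multiset ℕ).filter (fun x => x % 2 = 1)

lemma evh_odp (L : List ℕ) : (L : Multiset ℕ) = (evh L).map (fun x => 2 * x) + odp L := by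
  rw [evh, odp, Multiset.map_map]
  have : Multiset.map ((fun x => 2 * x) ∘ fun x => x / 2) (Multiset.filter (fun x => x % 2 = 0) (L : Multiset ℕ))
     = Multiset.filter (fun x => x % 2 = 0) (L : Multiset ℕ) := by
    conv_rhs => rw [← Multiset.map_id (Multiset.filter (fun x => x % 2 = 0) (L : Multiset ℕ))]
    apply Multiset.map_congr rfl
    intro x hx
    rw [Multiset.mem_filter] at hx
    simp only [Function.comp, id]
    omega
  rw [this]
  conv_lhs => rw [← Multiset.filter_add_not (fun x => x % 2 = 0) (L : Multiset ℕ)]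
  congr 1
  apply Multiset.filter_congr
  intro x _
  omega

lemma sum_evh_odp (L : List ℕ) : L.sum = 2 * (evh L).sum + (odp L).sum := by
  have := congrArg Multiset.sum (evh_odp L)
  rw [Multiset.sum_add, Multiset.sum_map_mul_left, Multiset.map_id', Multiset.sum_coe] at this
  exact this

lemma evh_nodup_of (L : List ℕ) (h : L.Pairwise (fun a b => a = b → Odd a)) : (evh L).Nodup := by
  rw [evh]
  apply Multiset.Nodup.map_on
  · intro x hx y hy hxy
    rw [Multiset.mem_filter] at hx hy
    omega
  · rw [Multiset.filter_coe, Multiset.coe_nodup, List.Nodup]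
    have := h.filter (fun x => decide (x % 2 = 0))
    refine List.Pairwise.imp_of_mem ?_ this
    intro a b ha _ hab e
    have h1 := hab e
    simp only [List.mem_filter, decide_eq_true_eq] at ha
    rw [Nat.odd_iff] at h1
    omega

lemma left_pairwise (L : List ℕ) (h : L.IsChain (fun a b => a ≤ b ∧ (a = b → Odd a))) :
    L.Pairwise (fun a b => a ≤ b ∧ (a = b → Odd a)) := by
  have : IsTrans ℕ (fun a b => a ≤ b ∧ (a = b → Odd a)) := ⟨by
    rintro a b c ⟨h1, h2⟩ ⟨h3, h4⟩
    refine ⟨h1.trans h3, ?_⟩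
    rintro rfl
    exact h2 (le_antisymm h1 h3)⟩
  exact List.isChain_iff_pairwise.1 h

lemma right_pairwise (L : List ℕ) (h : L.IsChain (fun a b => b ≤ a ∧ (a = b → Odd a))) :
    L.Pairwise (fun a b => b ≤ a ∧ (a = b → Odd a)) := by
  have : IsTrans ℕ (fun a b => b ≤ a ∧ (a = b → Odd a)) := ⟨by
    rintro a b c ⟨h1, h2⟩ ⟨h3, h4⟩
    refine ⟨h3.trans h1, ?_⟩
    rintro rfl
    exact h2 (le_antisymm h3 h1)⟩
  exact List.isChain_iff_pairwise.1 h

lemma left_eq (L L' : List ℕ) (h : L.IsChain (fun a b => a ≤ b ∧ (a = b → Odd a)))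
    (h' : L'.IsChain (fun a b => a ≤ b ∧ (a = b → Odd a))) (e1 : evh L = evh L') (e2 : odp L = odp L') : L = L' := by
  have : L.Perm L' := by
    rw [← Multiset.coe_eq_coe, evh_odp L, evh_odp L', e1, e2]
  exact this.eq_of_pairwise (fun a b _ _ (h1 : a ≤ b) h2 => le_antisymm h1 h2)
    ((left_pairwise L h).imp fun h => h.1) ((left_pairwise L' h').imp fun h => h.1)

lemma right_eq (L L' : List ℕ) (h : L.IsChain (fun a b => b ≤ a ∧ (a = b → Odd a)))
    (h' : L'.IsChain (fun a b => b ≤ a ∧ (a = b → Odd a))) (e1 : evh L = evh L') (e2 : odp L = odp L') : L = L' := by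
  have : L.Perm L' := by
    rw [← Multiset.coe_eq_coe, evh_odp L, evh_odp L', e1, e2]
  exact this.eq_of_pairwise (fun a b _ _ (h1 : b ≤ a) h2 => le_antisymm h2 h1)
    ((right_pairwise L h).imp fun h => h.1) ((right_pairwise L' h').imp fun h => h.1)

lemma IsOddBalanced.odp_eq {L R : List ℕ} {p : ℕ} (h : IsOddBalanced L p R) : odp L = odp R := by
  have := h.2.2.2.2.2.2.2.2
  have h2 := congrArg (fun l : List ℕ => (l : Multiset ℕ)) this
  rw [List.filter_reverse, Multiset.coe_reverse] at h2
  rw [odp, odp, Multiset.filter_coe, Multiset.filter_coe]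
  convert h2 using 3 <;> (funext x; rfl)

lemma mem_evh {L : List ℕ} {x : ℕ} (h : x ∈ evh L) : 2 * x ∈ L := by
  have : 2 * x ∈ (L : Multiset ℕ) := by
    rw [evh_odp L, Multiset.mem_add]
    left
    exact Multiset.mem_map_of_mem _ h
  exact this

/-- the sequences counted by `oddBalancedCountMod` -/
abbrev VT (a : ℤ) (c n : ℕ) := {x : List ℕ × ℕ × List ℕ //
    IsOddBalanced x.1 x.2.1 x.2.2 ∧ x.1.sum + x.2.1 + x.2.2.sum = 2 * n + 2 ∧
    (x.2.2.length : ℤ) - (x.1.length : ℤ) ≡ a [ZMOD (c : ℤ)]}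

def upMap (b : Bool) (x : List ℕ × ℕ × List ℕ) : Multiset ℕ × Multiset ℕ × Multiset ℕ :=
  if b then (x.2.1 / 2 ::ₘ evh x.1, evh x.2.2, odp x.1) else (evh x.1, x.2.1 / 2 ::ₘ evh x.2.2, odp x.1)

lemma evh_lt {L : List ℕ} {p : ℕ} (hp : Even p) (h : ∀ x ∈ L, x < p) : ∀ x ∈ evh L, x < p / 2 := by
  intro x hx
  have := h _ (mem_evh hx)
  obtain ⟨r, rfl⟩ := hp
  omega

lemma upMap_mem (b : Bool) (n : ℕ) (x : List ℕ × ℕ × List ℕ) (h : IsOddBalanced x.1 x.2.1 x.2.2)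
    (hs : x.1.sum + x.2.1 + x.2.2.sum = 2 * n + 2) : upMap b x ∈ TF (n + 1) := by
  have hodp := h.odp_eq
  obtain ⟨h1, h2, h3, h4, h5, h6, h7, h8, h9⟩ := h
  have nl : (evh x.1).Nodup := evh_nodup_of _ ((left_pairwise _ h5).imp fun h => h.2)
  have nr : (evh x.2.2).Nodup := evh_nodup_of _ ((right_pairwise _ h6).imp fun h => h.2)
  have pl : ∀ y ∈ evh x.1, 0 < y := fun y hy => by have := h3 _ (mem_evh hy); omega
  have pr : ∀ y ∈ evh x.2.2, 0 < y := fun y hy => by have := h4 _ (mem_evh hy); omega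
  have ll := evh_lt h1 h7
  have lr := evh_lt h1 h8
  have od : ∀ y ∈ odp x.1, Odd y := by
    intro y hy
    rw [odp, Multiset.mem_filter] at hy
    exact Nat.odd_iff.2 hy.2
  rw [sum_evh_odp x.1, sum_evh_odp x.2.2, ← hodp] at hs
  have hp : 2 * (x.2.1 / 2) = x.2.1 := Nat.two_mul_div_two_of_even h1
  rw [mem_TF, upMap]
  cases b
  · simp only [Bool.false_eq_true, if_false]
    refine ⟨nl, pl, ?_, ?_, od, ?_⟩
    · rw [Multiset.nodup_cons]; exact ⟨fun h => lt_irrefl _ (lr _ h), nr⟩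
    · intro y hy
      rw [Multiset.mem_cons] at hy
      rcases hy with rfl | hy
      · omega
      · exact pr y hy
    · rw [Multiset.sum_cons]; omega
  · simp only [if_true]
    refine ⟨?_, ?_, nr, pr, od, ?_⟩
    · rw [Multiset.nodup_cons]; exact ⟨fun h => lt_irrefl _ (ll _ h), nl⟩
    · intro y hy
      rw [Multiset.mem_cons] at hy
      rcases hy with rfl | hy
      · omega
      · exact pl y hy
    · rw [Multiset.sum_cons]; omega

lemma cons_max {p q : ℕ} {A B : Multiset ℕ} (hA : ∀ x ∈ A, x < p) (hB : ∀ x ∈ B, x < q)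
    (h : p ::ₘ A = q ::ₘ B) : p = q ∧ A = B := by
  have h1 : p ∈ q ::ₘ B := by rw [← h]; simp
  have h2 : q ∈ p ::ₘ A := by rw [h]; simp
  have : p = q := by
    rw [Multiset.mem_cons] at h1 h2
    rcases h1 with h1 | h1
    · exact h1
    · rcases h2 with h2 | h2
      · exact h2.symm
      · have := hA _ h2; have := hB _ h1; omega
  subst this
  exact ⟨rfl, (Multiset.cons_inj_right _).1 h⟩

lemma seq_ext {x y : List ℕ × ℕ × List ℕ} (hx : IsOddBalanced x.1 x.2.1 x.2.2) (hy : IsOddBalanced y.1 y.2.1 y.2.2)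
    (hp : x.2.1 / 2 = y.2.1 / 2) (e1 : evh x.1 = evh y.1) (e2 : evh x.2.2 = evh y.2.2) (e3 : odp x.1 = odp y.1) :
    x = y := by
  have hp1 : 2 * (x.2.1 / 2) = x.2.1 := Nat.two_mul_div_two_of_even hx.1
  have hp2 : 2 * (y.2.1 / 2) = y.2.1 := Nat.two_mul_div_two_of_even hy.1
  have ox := hx.odp_eq
  have oy := hy.odp_eq
  ext1
  · exact left_eq _ _ hx.2.2.2.2.1 hy.2.2.2.2.1 e1 e3
  · ext1
    · omega
    · exact right_eq _ _ hx.2.2.2.2.2.1 hy.2.2.2.2.2.1 e2 (by rw [← ox, ← oy, e3])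

lemma upMap_inj {b b' : Bool} {x y : List ℕ × ℕ × List ℕ} (hx : IsOddBalanced x.1 x.2.1 x.2.2)
    (hy : IsOddBalanced y.1 y.2.1 y.2.2) (h : upMap b x = upMap b' y) : b = b' ∧ x = y := by
  have llx := evh_lt hx.1 hx.2.2.2.2.2.2.1
  have lrx := evh_lt hx.1 hx.2.2.2.2.2.2.2.1
  have lly := evh_lt hy.1 hy.2.2.2.2.2.2.1
  have lry := evh_lt hy.1 hy.2.2.2.2.2.2.2.1
  cases b <;> cases b' <;> simp only [upMap, Bool.false_eq_true, if_false, if_true, Prod.mk.injEq] at h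
  · obtain ⟨h1, h2, h3⟩ := h
    obtain ⟨h4, h5⟩ := cons_max lrx lry h2
    exact ⟨rfl, seq_ext hx hy h4 h1 h5 h3⟩
  · exfalso
    obtain ⟨h1, h2, h3⟩ := h
    have a1 := llx (y.2.1 / 2) (by rw [h1]; simp)
    have a2 := lry (x.2.1 / 2) (by rw [← h2]; simp)
    omega
  · exfalso
    obtain ⟨h1, h2, h3⟩ := h
    have a1 := lly (x.2.1 / 2) (by rw [← h1]; simp)
    have a2 := lrx (y.2.1 / 2) (by rw [h2]; simp)
    omega
  · obtain ⟨h1, h2, h3⟩ := h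
    obtain ⟨h4, h5⟩ := cons_max llx lly h1
    exact ⟨rfl, seq_ext hx hy h4 h5 h2 h3⟩

def upMapT (a : ℤ) (c n : ℕ) (z : Bool × VT a c n) : TF (n + 1) :=
  ⟨upMap z.1 z.2.1, upMap_mem _ _ _ z.2.2.1 z.2.2.2.1⟩

lemma upMapT_inj (a : ℤ) (c n : ℕ) : Function.Injective (upMapT a c n) := by
  rintro ⟨b, x⟩ ⟨b', y⟩ h
  have := congrArg Subtype.val h
  obtain ⟨h1, h2⟩ := upMap_inj x.2.1 y.2.1 this
  ext1
  · exact h1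
  · exact Subtype.ext h2

instance VT_finite (a : ℤ) (c n : ℕ) : Finite (VT a c n) := by
  have : Function.Injective (fun x : VT a c n => upMapT a c n (true, x)) := by
    intro x y h
    have := upMapT_inj a c n h
    simpa using this
  exact Finite.of_injective _ this

lemma upper_bound (a : ℤ) (c n : ℕ) : 2 * oddBalancedCountMod a c n ≤ tt (n + 1) := by
  have h := Nat.card_le_card_of_injective _ (upMapT_inj a c n)
  rw [Nat.card_prod, Nat.card_eq_fintype_card (α := Bool), Fintype.card_bool] at h
  rw [Nat.card_eq_fintype_card (α := TF (n + 1)), Fintype.card_coe, card_TF] at h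
  exact h


/-! ### Lower bound -/

def mkl (A M : Multiset ℕ) : List ℕ := (A.map (fun x => 2 * x) + M).sort

lemma coe_mkl (A M : Multiset ℕ) : (mkl A M : Multiset ℕ) = A.map (fun x => 2 * x) + M :=
  Multiset.sort_eq _ _

lemma filter_even_mkl (A M : Multiset ℕ) (hM : ∀ y ∈ M, Odd y) :
    (mkl A M : Multiset ℕ).filter (fun x => x % 2 = 0) = A.map (fun x => 2 * x) := by
  rw [coe_mkl, Multiset.filter_add, Multiset.filter_eq_self.2, Multiset.filter_eq_nil.2, add_zero]
  · intro y hy h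
    have := Nat.odd_iff.1 (hM y hy)
    omega
  · intro y hy
    rw [Multiset.mem_map] at hy
    obtain ⟨x, _, rfl⟩ := hy
    omega

lemma odp_mkl (A M : Multiset ℕ) (hM : ∀ y ∈ M, Odd y) : odp (mkl A M) = M := by
  rw [odp, coe_mkl, Multiset.filter_add, Multiset.filter_eq_nil.2, Multiset.filter_eq_self.2, zero_add]
  · intro y hy
    exact Nat.odd_iff.1 (hM y hy)
  · intro y hy
    rw [Multiset.mem_map] at hy
    obtain ⟨x, _, rfl⟩ := hy
    omega

lemma evh_mkl (A M : Multiset ℕ) (hM : ∀ y ∈ M, Odd y) : evh (mkl A M) = A := by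
  rw [evh, filter_even_mkl A M hM, Multiset.map_map]
  conv_rhs => rw [← Multiset.map_id A]
  apply Multiset.map_congr rfl
  intro x _
  simp

lemma pairwise_odd_of (l : List ℕ) (h : ((l : Multiset ℕ).filter (fun x => x % 2 = 0)).Nodup) :
    l.Pairwise (fun a b => a = b → Odd a) := by
  induction l with
  | nil => exact List.Pairwise.nil
  | cons x l ih =>
    rw [← Multiset.cons_coe] at h
    rw [List.pairwise_cons]
    constructor
    · rintro b hb rfl
      by_contra hx
      rw [Nat.not_odd_iff] at hx
      rw [Multiset.filter_cons_of_pos (p := fun x => x % 2 = 0) _ hx, Multiset.nodup_cons] at h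
      exact h.1 (by rw [Multiset.mem_filter]; exact ⟨hb, hx⟩)
    · apply ih
      exact Multiset.nodup_of_le (Multiset.filter_le_filter _ (Multiset.le_cons_self _ _)) h

lemma mkl_le_pairwise (A M : Multiset ℕ) : (mkl A M).Pairwise (fun a b => a ≤ b) :=
  Multiset.pairwise_sort _ _

lemma mkl_pairwise (A M : Multiset ℕ) (hA : A.Nodup) (hM : ∀ y ∈ M, Odd y) :
    (mkl A M).Pairwise (fun a b => a ≤ b ∧ (a = b → Odd a)) := by
  refine List.Pairwise.and (mkl_le_pairwise A M) (pairwise_odd_of _ ?_)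
  rw [filter_even_mkl A M hM]
  exact hA.map (fun x y h => by simpa using h)

lemma mem_mkl (A M : Multiset ℕ) (x : ℕ) (h : x ∈ mkl A M) : (∃ y ∈ A, 2 * y = x) ∨ x ∈ M := by
  have : x ∈ (mkl A M : Multiset ℕ) := h
  rw [coe_mkl, Multiset.mem_add, Multiset.mem_map] at this
  exact this

lemma mkl_balanced (A B M : Multiset ℕ) (k : ℕ) (hA : A.Nodup) (hB : B.Nodup) (hM : ∀ y ∈ M, Odd y)
    (pA : ∀ y ∈ A, 0 < y ∧ y ≤ k) (pB : ∀ y ∈ B, 0 < y ∧ y ≤ k) (pM : ∀ y ∈ M, y < 2 * k + 2) :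
    IsOddBalanced (mkl A M) (2 * k + 2) (mkl B M).reverse := by
  refine ⟨⟨k + 1, by ring⟩, by omega, ?_, ?_, ?_, ?_, ?_, ?_, ?_⟩
  · intro x hx
    rcases mem_mkl _ _ _ hx with ⟨y, hy, rfl⟩ | h
    · have := pA y hy; omega
    · exact (hM x h).pos
  · intro x hx
    rcases mem_mkl _ _ _ (List.mem_reverse.1 hx) with ⟨y, hy, rfl⟩ | h
    · have := pB y hy; omega
    · exact (hM x h).pos
  · exact (mkl_pairwise A M hA hM).isChain
  · apply List.Pairwise.isChain
    rw [List.pairwise_reverse]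
    refine (mkl_pairwise B M hB hM).imp ?_
    rintro a b ⟨h1, h2⟩
    exact ⟨h1, fun h => by rw [h]; exact h2 h.symm⟩
  · intro x hx
    rcases mem_mkl _ _ _ hx with ⟨y, hy, rfl⟩ | h
    · have := pA y hy; omega
    · exact pM x h
  · intro x hx
    rcases mem_mkl _ _ _ (List.mem_reverse.1 hx) with ⟨y, hy, rfl⟩ | h
    · have := pB y hy; omega
    · exact pM x h
  · rw [List.reverse_reverse]
    have e : ∀ A, ((mkl A M).filter (fun x => x % 2 == 1) : Multiset ℕ) = odp (mkl A M) := by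
      intro A
      rw [odp, Multiset.filter_coe]
      rfl
    have hp : ((mkl A M).filter (fun x => x % 2 == 1)).Perm ((mkl B M).filter (fun x => x % 2 == 1)) := by
      rw [← Multiset.coe_eq_coe, e, e, odp_mkl A M hM, odp_mkl B M hM]
    exact hp.eq_of_pairwise (fun a b _ _ (h1 : a ≤ b) h2 => le_antisymm h1 h2)
      ((mkl_le_pairwise A M).filter _) ((mkl_le_pairwise B M).filter _)

lemma sum_mkl (A M : Multiset ℕ) : (mkl A M).sum = 2 * A.sum + M.sum := by
  have := congrArg Multiset.sum (coe_mkl A M)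
  rw [Multiset.sum_add, Multiset.sum_map_mul_left, Multiset.map_id', Multiset.sum_coe] at this
  exact this

lemma length_mkl (A M : Multiset ℕ) : (mkl A M).length = A.card + M.card := by
  rw [mkl, Multiset.length_sort]; simp

/-- residue correction -/
def rr (a : ℤ) (c : ℕ) (A B : Multiset ℕ) : ℕ :=
  ((a - (B.filter (fun x => c < x)).card + A.card) % (c : ℤ)).toNat

lemma rr_lt (a : ℤ) (c : ℕ) (hc : 0 < c) (A B : Multiset ℕ) : rr a c A B < c := by
  rw [rr]
  have h1 := Int.emod_lt_of_pos (a - (B.filter (fun x => c < x)).card + A.card) (b := (c : ℤ)) (by omega)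
  have h2 := Int.emod_nonneg (a - (B.filter (fun x => c < x)).card + A.card) (b := (c : ℤ)) (by omega)
  omega

lemma rr_cast (a : ℤ) (c : ℕ) (hc : 0 < c) (A B : Multiset ℕ) :
    ((rr a c A B : ℕ) : ℤ) ≡ a - (B.filter (fun x => c < x)).card + A.card [ZMOD (c : ℤ)] := by
  rw [rr, Int.toNat_of_nonneg (Int.emod_nonneg _ (by omega))]
  exact Int.mod_modEq _ _

def BB (a : ℤ) (c : ℕ) (A B : Multiset ℕ) : Multiset ℕ :=
  B.filter (fun x => c < x) + (Finset.Icc 1 (rr a c A B)).val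

def tri (r : ℕ) : ℕ := (Finset.Icc 1 r).val.sum

lemma tri_le (r c : ℕ) (h : r < c) : tri r ≤ c ^ 2 := by
  have : ∑ i ∈ Finset.Icc 1 r, i ≤ (Finset.Icc 1 r).card • c :=
    Finset.sum_le_card_nsmul _ _ _ (fun x hx => by rw [Finset.mem_Icc] at hx; omega)
  have e : tri r = ∑ i ∈ Finset.Icc 1 r, i := by
    rw [tri, Finset.sum, Multiset.map_id']
  rw [e]
  simp only [Nat.card_Icc, smul_eq_mul, Nat.add_sub_cancel] at this
  nlinarith

lemma filter_BB (a : ℤ) (c : ℕ) (hc : 0 < c) (A B : Multiset ℕ) :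
    (BB a c A B).filter (fun x => c < x) = B.filter (fun x => c < x) := by
  rw [BB, Multiset.filter_add, Multiset.filter_filter]
  have : Multiset.filter (fun x => c < x) (Finset.Icc 1 (rr a c A B)).val = 0 := by
    rw [Multiset.filter_eq_nil]
    intro x hx
    have := rr_lt a c hc A B
    rw [Finset.mem_val, Finset.mem_Icc] at hx
    omega
  rw [this, add_zero]
  apply Multiset.filter_congr; simp

lemma card_BB (a : ℤ) (c : ℕ) (A B : Multiset ℕ) :
    (BB a c A B).card = (B.filter (fun x => c < x)).card + rr a c A B := by
  rw [BB, Multiset.card_add]; simp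

def LL (c : ℕ) (B : Multiset ℕ) : Multiset ℕ := B.filter (fun x => ¬ c < x)

def MM (a : ℤ) (c n k m : ℕ) (x : Multiset ℕ × Multiset ℕ × Multiset ℕ) : Multiset ℕ :=
  x.2.2 + Multiset.replicate ((n - k - m) + (LL c x.2.1).sum - tri (rr a c x.1 x.2.1)) 1

def dn (a : ℤ) (c n k m : ℕ) (x : Multiset ℕ × Multiset ℕ × Multiset ℕ) : List ℕ × ℕ × List ℕ :=
  (mkl x.1 (MM a c n k m x), 2 * k + 2, (mkl (BB a c x.1 x.2.1) (MM a c n k m x)).reverse)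

def GF (m k : ℕ) : Finset (Multiset ℕ × Multiset ℕ × Multiset ℕ) :=
  (TF m).filter (fun x => (∀ y ∈ x.1, y ≤ k) ∧ (∀ y ∈ x.2.1, y ≤ k) ∧ (∀ y ∈ x.2.2, y ≤ k))

lemma MM_odd (a : ℤ) (c n k m : ℕ) (x : Multiset ℕ × Multiset ℕ × Multiset ℕ) (hx : x ∈ GF m k) :
    ∀ y ∈ MM a c n k m x, Odd y ∧ y < 2 * k + 2 := by
  rw [GF, Finset.mem_filter, mem_TF] at hx
  obtain ⟨⟨h1, h2, h3, h4, h5, h6⟩, h7, h8, h9⟩ := hx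
  intro y hy
  rw [MM, Multiset.mem_add] at hy
  rcases hy with hy | hy
  · have := h9 y hy
    exact ⟨h5 y hy, by omega⟩
  · have := Multiset.eq_of_mem_replicate hy
    subst this
    exact ⟨odd_one, by omega⟩

lemma dn_spec (a : ℤ) (c n k m : ℕ) (hc : 0 < c) (hk : c ≤ k) (hn : m + k + c ^ 2 ≤ n)
    (x : Multiset ℕ × Multiset ℕ × Multiset ℕ) (hx : x ∈ GF m k) :
    IsOddBalanced (dn a c n k m x).1 (dn a c n k m x).2.1 (dn a c n k m x).2.2 ∧
    (dn a c n k m x).1.sum + (dn a c n k m x).2.1 + (dn a c n k m x).2.2.sum = 2 * n + 2 ∧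
    ((dn a c n k m x).2.2.length : ℤ) - ((dn a c n k m x).1.length : ℤ) ≡ a [ZMOD (c : ℤ)] := by
  have hM := MM_odd a c n k m x hx
  rw [GF, Finset.mem_filter, mem_TF] at hx
  obtain ⟨⟨h1, h2, h3, h4, h5, h6⟩, h7, h8, h9⟩ := hx
  have hr := rr_lt a c hc x.1 x.2.1
  refine ⟨?_, ?_, ?_⟩
  · apply mkl_balanced
    · exact h1
    · rw [BB, Multiset.nodup_add]
      refine ⟨h3.filter _, Finset.nodup _, ?_⟩
      rw [Multiset.disjoint_left]
      intro y hy hy2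
      rw [Multiset.mem_filter] at hy
      rw [Finset.mem_val, Finset.mem_Icc] at hy2
      omega
    · exact fun y hy => (hM y hy).1
    · exact fun y hy => ⟨h2 y hy, h7 y hy⟩
    · intro y hy
      rw [BB, Multiset.mem_add] at hy
      rcases hy with hy | hy
      · rw [Multiset.mem_filter] at hy
        exact ⟨h4 y hy.1, h8 y hy.1⟩
      · rw [Finset.mem_val, Finset.mem_Icc] at hy
        omega
    · exact fun y hy => (hM y hy).2
  · simp only [dn]
    rw [List.sum_reverse, sum_mkl, sum_mkl]
    have e1 : (MM a c n k m x).sum = x.2.2.sum + ((n - k - m) + (LL c x.2.1).sum - tri (rr a c x.1 x.2.1)) := by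
      rw [MM, Multiset.sum_add, Multiset.sum_replicate]; simp
    have e2 : (BB a c x.1 x.2.1).sum = (x.2.1.filter (fun x => c < x)).sum + tri (rr a c x.1 x.2.1) := by
      rw [BB, Multiset.sum_add]; rfl
    have e3 : x.2.1.sum = (x.2.1.filter (fun x => c < x)).sum + (LL c x.2.1).sum := by
      rw [LL, ← Multiset.sum_add, Multiset.filter_add_not]
    have := tri_le _ _ hr
    omega
  · simp only [dn]
    rw [List.length_reverse, length_mkl, length_mkl, card_BB]
    have := rr_cast a c hc x.1 x.2.1
    push_cast
    have h := (this.add_left ((x.2.1.filter (fun x => c < x)).card : ℤ)).add_right (-(x.1.card : ℤ))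
    convert h using 1 <;> ring

lemma evh_reverse (L : List ℕ) : evh L.reverse = evh L := by
  rw [evh, Multiset.coe_reverse, evh]

lemma dn_inj (a : ℤ) (c n k m : ℕ) (hc : 0 < c)
    (x y : Multiset ℕ × Multiset ℕ × Multiset ℕ) (hx : x ∈ GF m k) (hy : y ∈ GF m k)
    (h : dn a c n k m x = dn a c n k m y) (hl : LL c x.2.1 = LL c y.2.1) : x = y := by
  have ox := fun z hz => (MM_odd a c n k m x hx z hz).1
  have oy := fun z hz => (MM_odd a c n k m y hy z hz).1
  have hL : mkl x.1 (MM a c n k m x) = mkl y.1 (MM a c n k m y) := congrArg Prod.fst h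
  have hR : (mkl (BB a c x.1 x.2.1) (MM a c n k m x)).reverse = (mkl (BB a c y.1 y.2.1) (MM a c n k m y)).reverse :=
    congrArg (fun z => z.2.2) h
  have hA : x.1 = y.1 := by
    rw [← evh_mkl x.1 _ ox, ← evh_mkl y.1 _ oy, hL]
  have hB : BB a c x.1 x.2.1 = BB a c y.1 y.2.1 := by
    rw [← evh_mkl (BB a c x.1 x.2.1) _ ox, ← evh_mkl (BB a c y.1 y.2.1) _ oy, ← evh_reverse, hR, evh_reverse]
  have hM : MM a c n k m x = MM a c n k m y := by
    rw [← odp_mkl x.1 _ ox, ← odp_mkl y.1 _ oy, hL]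
  have hF : x.2.1.filter (fun x => c < x) = y.2.1.filter (fun x => c < x) := by
    rw [← filter_BB a c hc x.1 x.2.1, hB, filter_BB a c hc]
  have hB2 : x.2.1 = y.2.1 := by
    rw [← Multiset.filter_add_not (fun z => c < z) x.2.1, ← Multiset.filter_add_not (fun z => c < z) y.2.1, hF]
    congr 1
  have hm : x.2.2 = y.2.2 := by
    rw [MM, MM, hB2, hA] at hM
    exact add_right_cancel hM
  exact Prod.ext hA (Prod.ext hB2 hm)

lemma LL_mem (c m k : ℕ) (x : Multiset ℕ × Multiset ℕ × Multiset ℕ) (hx : x ∈ GF m k) :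
    (LL c x.2.1).toFinset ∈ (Finset.Icc 1 c).powerset := by
  rw [GF, Finset.mem_filter, mem_TF] at hx
  obtain ⟨⟨h1, h2, h3, h4, h5, h6⟩, h7, h8, h9⟩ := hx
  rw [Finset.mem_powerset]
  intro y hy
  rw [Multiset.mem_toFinset, LL, Multiset.mem_filter] at hy
  have := h4 y hy.1
  rw [Finset.mem_Icc]
  omega

lemma LL_eq (c m k : ℕ) (x : Multiset ℕ × Multiset ℕ × Multiset ℕ) (hx : x ∈ GF m k) :
    (LL c x.2.1).toFinset.val = LL c x.2.1 := by
  rw [GF, Finset.mem_filter, mem_TF] at hx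
  obtain ⟨⟨h1, h2, h3, h4, h5, h6⟩, h7, h8, h9⟩ := hx
  rw [Multiset.toFinset_val, Multiset.dedup_eq_self]
  exact h3.filter _

lemma card_GF_le (a : ℤ) (c n k m : ℕ) (hc : 0 < c) (hk : c ≤ k) (hn : m + k + c ^ 2 ≤ n) :
    (GF m k).card ≤ 2 ^ c * oddBalancedCountMod a c n := by
  let f : GF m k → (Finset.Icc 1 c).powerset × VT a c n := fun x =>
    (⟨(LL c x.1.2.1).toFinset, LL_mem c m k x.1 x.2⟩, ⟨dn a c n k m x.1, dn_spec a c n k m hc hk hn x.1 x.2⟩)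
  have hf : Function.Injective f := by
    rintro ⟨x, hx⟩ ⟨y, hy⟩ h
    have h1 : (LL c x.2.1).toFinset = (LL c y.2.1).toFinset := congrArg (fun z => z.1.1) h
    have h2 : dn a c n k m x = dn a c n k m y := congrArg (fun z => z.2.1) h
    have h3 : LL c x.2.1 = LL c y.2.1 := by rw [← LL_eq c m k x hx, h1, LL_eq c m k y hy]
    exact Subtype.ext (dn_inj a c n k m hc x y hx hy h2 h3)
  have h := Nat.card_le_card_of_injective f hf
  rw [Nat.card_prod, Nat.card_eq_fintype_card (α := GF m k), Fintype.card_coe,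
    Nat.card_eq_fintype_card (α := (Finset.Icc 1 c).powerset), Fintype.card_coe, Finset.card_powerset] at h
  have e : oddBalancedCountMod a c n = Nat.card (VT a c n) := rfl
  rw [e]
  simpa using h

lemma card_bad1 (m j : ℕ) (hj : j ≤ m) : ((TF m).filter (fun x => j ∈ x.1)).card ≤ tt (m - j) := by
  rw [← card_TF]
  apply Finset.card_le_card_of_injOn (fun x => (x.1.erase j, x.2))
  · intro x hx
    simp only [Finset.coe_filter, Set.mem_ofPred_eq, mem_TF] at hx
    obtain ⟨⟨h1, h2, h3, h4, h5, h6⟩, h7⟩ := hx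
    have := Multiset.sum_erase h7
    rw [Finset.mem_coe, mem_TF]
    exact ⟨h1.erase _, fun y hy => h2 y (Multiset.mem_of_mem_erase hy), h3, h4, h5, by simp only; omega⟩
  · intro x hx y hy h
    simp only [Finset.coe_filter, Set.mem_ofPred_eq] at hx hy
    simp only [Prod.mk.injEq] at h
    refine Prod.ext ?_ h.2
    rw [← Multiset.cons_erase hx.2, ← Multiset.cons_erase hy.2, h.1]

lemma card_bad2 (m j : ℕ) (hj : j ≤ m) : ((TF m).filter (fun x => j ∈ x.2.1)).card ≤ tt (m - j) := by
  rw [← card_TF]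
  apply Finset.card_le_card_of_injOn (fun x => (x.1, x.2.1.erase j, x.2.2))
  · intro x hx
    simp only [Finset.coe_filter, Set.mem_ofPred_eq, mem_TF] at hx
    obtain ⟨⟨h1, h2, h3, h4, h5, h6⟩, h7⟩ := hx
    have := Multiset.sum_erase h7
    rw [Finset.mem_coe, mem_TF]
    exact ⟨h1, h2, h3.erase _, fun y hy => h4 y (Multiset.mem_of_mem_erase hy), h5, by simp only; omega⟩
  · intro x hx y hy h
    simp only [Finset.coe_filter, Set.mem_ofPred_eq] at hx hy
    simp only [Prod.mk.injEq] at h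
    refine Prod.ext h.1 (Prod.ext ?_ h.2.2)
    rw [← Multiset.cons_erase hx.2, ← Multiset.cons_erase hy.2, h.2.1]

lemma card_bad3 (m j : ℕ) (hj : j ≤ m) : ((TF m).filter (fun x => j ∈ x.2.2)).card ≤ tt (m - j) := by
  rw [← card_TF]
  apply Finset.card_le_card_of_injOn (fun x => (x.1, x.2.1, x.2.2.erase j))
  · intro x hx
    simp only [Finset.coe_filter, Set.mem_ofPred_eq, mem_TF] at hx
    obtain ⟨⟨h1, h2, h3, h4, h5, h6⟩, h7⟩ := hx
    have := Multiset.sum_erase h7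
    rw [Finset.mem_coe, mem_TF]
    exact ⟨h1, h2, h3, h4, fun y hy => h5 y (Multiset.mem_of_mem_erase hy), by simp only; omega⟩
  · intro x hx y hy h
    simp only [Finset.coe_filter, Set.mem_ofPred_eq] at hx hy
    simp only [Prod.mk.injEq] at h
    refine Prod.ext h.1 (Prod.ext h.2.1 ?_)
    rw [← Multiset.cons_erase hx.2, ← Multiset.cons_erase hy.2, h.2.2]

lemma TF_subset (m k : ℕ) : TF m ⊆ GF m k ∪ (Finset.Ioc k m).biUnion (fun j =>
    (TF m).filter (fun x => j ∈ x.1) ∪ ((TF m).filter (fun x => j ∈ x.2.1) ∪ (TF m).filter (fun x => j ∈ x.2.2))) := by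
  intro x hx
  rw [Finset.mem_union]
  by_cases hG : x ∈ GF m k
  · exact Or.inl hG
  right
  have hx' := (mem_TF m x).1 hx
  have : ∃ j, k < j ∧ (j ∈ x.1 ∨ j ∈ x.2.1 ∨ j ∈ x.2.2) := by
    by_contra hno
    push Not at hno
    apply hG
    rw [GF, Finset.mem_filter]
    refine ⟨hx, fun y hy => ?_, fun y hy => ?_, fun y hy => ?_⟩ <;>
    · by_contra hk
      have := hno y (by omega)
      tauto
  obtain ⟨j, hj, hjx⟩ := this
  have hjm : j ≤ m := by
    rcases hjx with h | h | h <;>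
    · have := Multiset.le_sum_of_mem h
      omega
  rw [Finset.mem_biUnion]
  refine ⟨j, Finset.mem_Ioc.2 ⟨hj, hjm⟩, ?_⟩
  simp only [Finset.mem_union, Finset.mem_filter]
  tauto

lemma lower_bound0 (a : ℤ) (c n k m : ℕ) (hc : 0 < c) (hk : c ≤ k) (hn : m + k + c ^ 2 ≤ n) :
    tt m ≤ 2 ^ c * oddBalancedCountMod a c n + ∑ j ∈ Finset.Ioc k m, 3 * tt (m - j) := by
  rw [← card_TF]
  refine (Finset.card_le_card (TF_subset m k)).trans ((Finset.card_union_le _ _).trans ?_)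
  refine Nat.add_le_add (card_GF_le a c n k m hc hk hn) (Finset.card_biUnion_le.trans ?_)
  apply Finset.sum_le_sum
  intro j hj
  have hjm := (Finset.mem_Ioc.1 hj).2
  have h1 := card_bad1 m j hjm
  have h2 := card_bad2 m j hjm
  have h3 := card_bad3 m j hjm
  have h4 := Finset.card_union_le ((TF m).filter (fun x => j ∈ x.1))
    ((TF m).filter (fun x => j ∈ x.2.1) ∪ (TF m).filter (fun x => j ∈ x.2.2))
  have h5 := Finset.card_union_le ((TF m).filter (fun x => j ∈ x.2.1)) ((TF m).filter (fun x => j ∈ x.2.2))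
  omega

lemma over_le_tt (m : ℕ) : overpartition m ≤ tt m := by
  rw [tt]
  have := Finset.single_le_sum (f := fun s => if s*(s+1)/2 ≤ m then overpartition (m - s*(s+1)/2) else 0)
    (s := Finset.range (m + 1)) (fun _ _ => Nat.zero_le _) (Finset.mem_range.2 (Nat.succ_pos m))
  simpa using this

lemma tt_le (m : ℕ) : tt m ≤ (m + 1) * overpartition m := by
  rw [tt]
  have : ∀ s ∈ Finset.range (m + 1), (if s*(s+1)/2 ≤ m then overpartition (m - s*(s+1)/2) else 0) ≤ overpartition m := by
    intro s _
    split_ifs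
    · exact over_mono (by omega)
    · exact Nat.zero_le _
  simpa using Finset.sum_le_card_nsmul _ _ _ this

lemma lower_bound (a : ℤ) (c n k m : ℕ) (hc : 0 < c) (hk : c ≤ k) (hn : m + k + c ^ 2 ≤ n) :
    overpartition m ≤ 2 ^ c * oddBalancedCountMod a c n + 3 * (m + 1) ^ 2 * overpartition (m - k) := by
  refine (over_le_tt m).trans ((lower_bound0 a c n k m hc hk hn).trans (Nat.add_le_add le_rfl ?_))
  have : ∀ j ∈ Finset.Ioc k m, 3 * tt (m - j) ≤ 3 * ((m + 1) * overpartition (m - k)) := by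
    intro j hj
    rw [Finset.mem_Ioc] at hj
    have h1 := tt_le (m - j)
    have h2 : overpartition (m - j) ≤ overpartition (m - k) := over_mono (by omega)
    have h3 : (m - j + 1) * overpartition (m - j) ≤ (m + 1) * overpartition (m - k) :=
      Nat.mul_le_mul (by omega) h2
    omega
  have h := Finset.sum_le_card_nsmul _ _ _ this
  rw [Nat.card_Ioc, smul_eq_mul] at h
  refine h.trans ?_
  calc (m - k) * (3 * ((m + 1) * overpartition (m - k))) ≤ (m + 1) * (3 * ((m + 1) * overpartition (m - k))) :=
        Nat.mul_le_mul (by omega) le_rfl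
    _ = _ := by ring


/-! ### Analysis of the overpartition function -/

def PR (n : ℕ) : ℝ := (overpartition n : ℝ)
def SR (n : ℕ) : ℝ := ∑ i ∈ Finset.range (n + 1), PR i

lemma SR_cast (n : ℕ) : SR n = (SS n : ℝ) := by
  rw [SR, SS]; push_cast; rfl

lemma SR_succ (n : ℕ) : SR (n + 1) = SR n + PR (n + 1) := by
  rw [SR, Finset.sum_range_succ, ← SR]

lemma PR_pos (n : ℕ) : 0 < PR n := by
  rw [PR]; exact_mod_cast over_pos n

lemma PR_one_le (n : ℕ) : 1 ≤ PR n := by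
  rw [PR]; exact_mod_cast over_pos n

lemma PR_mono : Monotone PR := fun _ _ h => by
  rw [PR, PR]; exact_mod_cast over_mono h

lemma SR_pos (n : ℕ) : 0 < SR n := Finset.sum_pos (fun i _ => PR_pos i) (by simp)

lemma PR_le_SR (n : ℕ) : PR n ≤ SR n := by
  rw [SR, Finset.sum_range_succ]
  have : 0 ≤ ∑ i ∈ Finset.range n, PR i := Finset.sum_nonneg (fun i _ => (PR_pos i).le)
  linarith

lemma SR_le (n : ℕ) : SR n ≤ (n + 1) * PR n := by
  have : ∀ i ∈ Finset.range (n + 1), PR i ≤ PR n := fun i hi => PR_mono (by rw [Finset.mem_range] at hi; omega)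
  have := Finset.sum_le_card_nsmul _ _ _ this
  rw [Finset.card_range, nsmul_eq_mul] at this
  push_cast at this
  exact this

lemma PR_upper (n : ℕ) : ((n : ℝ) + 1) * PR (n + 1) - n * PR n ≤ 3 * SR n := by
  have := over_upper n
  rw [SR_cast, PR, PR]
  exact_mod_cast this

lemma PR_lower (n : ℕ) : 2 * SR n ≤ ((n : ℝ) + 1) * PR (n + 1) - n * PR n := by
  have := over_lower n
  rw [SR_cast, PR, PR]
  exact_mod_cast this

lemma PR_succ_le (n : ℕ) : PR (n + 1) ≤ 4 * PR n := by
  have h1 := PR_upper n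
  have h2 := SR_le n
  have h3 := PR_pos n
  have h4 : (0 : ℝ) < n + 1 := by positivity
  have : ((n : ℝ) + 1) * PR (n + 1) ≤ (n + 1) * (4 * PR n) := by nlinarith
  exact le_of_mul_le_mul_left this h4

lemma quad1 (n : ℕ) : ((n : ℝ) + 1) * PR (n + 1) ^ 2 ≤ 3 * (SR (n + 1) * SR n) +
    ∑ i ∈ Finset.range (n + 1), PR i ^ 2 := by
  induction n with
  | zero =>
    have h1 := PR_upper 0
    have h2 := PR_pos 0
    have h3 := PR_pos 1
    have e0 : SR 0 = PR 0 := by simp [SR]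
    have e1 := SR_succ 0
    simp only [zero_add] at *
    rw [e1, e0] 
    rw [e0] at h1
    simp at h1 ⊢
    nlinarith [mul_pos h2 h3]
  | succ n ih =>
    have h1 := PR_upper (n + 1)
    rw [Finset.sum_range_succ]
    have h2 := PR_pos (n + 1)
    have h3 := PR_pos (n + 2)
    have e1 := SR_succ n
    have e2 := SR_succ (n + 1)
    have h4 : PR (n + 1) ≤ PR (n + 1 + 1) := PR_mono (by omega)
    push_cast at h1 ⊢
    have h5 : ((n : ℝ) + 1 + 1) * (PR (n + 1 + 1) - PR (n + 1)) ≤ 3 * SR (n + 1) := by linarith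
    have h6 := mul_le_mul_of_nonneg_right h5 (show 0 ≤ PR (n + 1 + 1) + PR (n + 1) by linarith)
    rw [e2]
    have e3 : SR n = SR (n + 1) - PR (n + 1) := by linarith
    rw [e3] at ih
    nlinarith

lemma quad2 (n : ℕ) : ((n : ℝ) + 1) * PR (n + 1) ^ 2 ≤ 3 * SR n ^ 2 + 4 * PR (n + 1) * SR n := by
  have h1 := quad1 n
  have h2 : ∑ i ∈ Finset.range (n + 1), PR i ^ 2 ≤ PR (n + 1) * SR n := by
    rw [SR, Finset.mul_sum]
    apply Finset.sum_le_sum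
    intro i hi
    have : PR i ≤ PR (n + 1) := PR_mono (by rw [Finset.mem_range] at hi; omega)
    have := PR_pos i
    nlinarith
  rw [SR_succ] at h1
  nlinarith

lemma ratio_PS (n : ℕ) (hn : 1600 ≤ n + 1) : PR (n + 1) * √((n : ℝ) + 1) ≤ (9 / 5) * SR n := by
  have h := quad2 n
  set r := √((n : ℝ) + 1) with hr
  have hr2 : r ^ 2 = (n : ℝ) + 1 := Real.sq_sqrt (by positivity)
  have hr40 : 40 ≤ r := by
    apply Real.le_sqrt_of_sq_le
    have : ((1600 : ℕ) : ℝ) ≤ ((n + 1 : ℕ) : ℝ) := by exact_mod_cast hn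
    push_cast at this
    linarith
  clear hn
  by_contra hcon
  push Not at hcon
  have hx := PR_pos (n + 1)
  have hs := SR_pos n
  rw [← hr2] at h
  set x := PR (n + 1)
  set s := SR n
  have h40 : 40 * x ≤ x * r := by nlinarith
  -- y = x r
  have h2 : (x * r) ^ 2 ≤ 3 * s ^ 2 + (1 / 10) * (x * r) * s := by nlinarith
  nlinarith [mul_pos hs (sub_pos.2 hcon), mul_pos (sub_pos.2 hcon) (sub_pos.2 hcon)]

lemma PR_step (n : ℕ) (hn : 1600 ≤ n + 1) : PR n ≤ Real.exp (-(1 / √((n : ℝ) + 1))) * PR (n + 1) := by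
  have h := ratio_PS n hn
  have hl := PR_lower n
  set r := √((n : ℝ) + 1) with hr
  have hr2 : r ^ 2 = (n : ℝ) + 1 := Real.sq_sqrt (by positivity)
  have hr40 : 40 ≤ r := by
    apply Real.le_sqrt_of_sq_le
    have : ((1600 : ℕ) : ℝ) ≤ ((n + 1 : ℕ) : ℝ) := by exact_mod_cast hn
    push_cast at this
    linarith
  clear hn
  have hm : PR n ≤ PR (n + 1) := PR_mono (by omega)
  have hx := PR_pos (n + 1)
  have h1 : r ^ 2 * (PR (n + 1) - PR n) ≥ r * PR (n + 1) := by
    rw [hr2]; nlinarith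
  have hrp : 0 < r := by linarith
  have h2 : PR n ≤ (1 - 1 / r) * PR (n + 1) := by
    have : r * (PR (n + 1) - PR n) ≥ PR (n + 1) := by
      by_contra hcon
      push Not at hcon
      nlinarith
    have e : r * ((1 - 1 / r) * PR (n + 1)) = r * PR (n + 1) - PR (n + 1) := by field_simp
    have : r * PR n ≤ r * ((1 - 1 / r) * PR (n + 1)) := by rw [e]; linarith
    exact le_of_mul_le_mul_left this hrp
  refine h2.trans (mul_le_mul_of_nonneg_right ?_ hx.le)
  have := Real.add_one_le_exp (-(1 / r))
  linarith

lemma PR_decay1 (j d : ℕ) (hj : 1600 ≤ j + 1) : PR j ≤ Real.exp (-(d / √((j + d : ℕ) : ℝ))) * PR (j + d) := by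
  induction d with
  | zero => simp
  | succ d ih =>
    have h := PR_step (j + d) (by omega)
    have hq : (0:ℝ) < ((j + d : ℕ) : ℝ) := by
      have : 0 < j + d := by omega
      exact_mod_cast this
    calc PR j ≤ Real.exp (-(d / √((j + d : ℕ) : ℝ))) * PR (j + d) := ih
      _ ≤ Real.exp (-(d / √((j + (d + 1) : ℕ) : ℝ))) * (Real.exp (-(1 / √(((j + d : ℕ) : ℝ) + 1))) * PR (j + d + 1)) := by
          apply mul_le_mul _ h (PR_pos _).le (Real.exp_pos _).le
          apply Real.exp_le_exp.2
          apply neg_le_neg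
          apply div_le_div_of_nonneg_left (by positivity) (Real.sqrt_pos.2 hq)
          apply Real.sqrt_le_sqrt
          push_cast; linarith
      _ = _ := by
          rw [← mul_assoc, ← Real.exp_add]
          have e : (((j + d : ℕ) : ℝ) + 1) = ((j + (d + 1) : ℕ) : ℝ) := by push_cast; ring
          rw [e, ← add_assoc j d 1]
          congr 2
          push_cast
          ring

lemma PR_decay (n s : ℕ) (hs : s ≤ n) : PR (n - s) ≤ Real.exp ((1600 - s) / √(n : ℝ)) * PR n := by
  by_cases h1 : 1600 ≤ n - s
  · have := PR_decay1 (n - s) s (by omega)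
    rw [Nat.sub_add_cancel hs] at this
    refine this.trans (mul_le_mul_of_nonneg_right (Real.exp_le_exp.2 ?_) (PR_pos _).le)
    rw [← neg_div]
    apply div_le_div_of_nonneg_right _ (Real.sqrt_nonneg _)
    linarith
  · by_cases h2 : 1600 ≤ n
    · have h3 : PR (n - s) ≤ PR 1600 := PR_mono (by omega)
      have := PR_decay1 1600 (n - 1600) (by omega)
      rw [Nat.add_sub_cancel' h2] at this
      refine h3.trans (this.trans (mul_le_mul_of_nonneg_right (Real.exp_le_exp.2 ?_) (PR_pos _).le))
      rw [← neg_div]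
      apply div_le_div_of_nonneg_right _ (Real.sqrt_nonneg _)
      rw [Nat.cast_sub h2]
      have : (s : ℝ) ≤ n := by exact_mod_cast hs
      push_cast
      linarith
    · have h3 : PR (n - s) ≤ PR n := PR_mono (by omega)
      have h4 : 1 ≤ Real.exp ((1600 - s) / √(n : ℝ)) := by
        apply Real.one_le_exp
        apply div_nonneg _ (Real.sqrt_nonneg _)
        have : (s : ℝ) ≤ (1600 : ℕ) := by exact_mod_cast (show s ≤ 1600 by omega)
        push_cast at this
        linarith
      nlinarith [PR_pos n]

lemma PR_growth (n : ℕ) (hn : 1600 ≤ n) : Real.exp (2 * √((n : ℝ) + 1) - 2 * √1601) ≤ PR n := by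
  induction n, hn using Nat.le_induction with
  | base =>
    have : ((1600 : ℕ) : ℝ) + 1 = 1601 := by norm_num
    rw [this, sub_self, Real.exp_zero]
    exact PR_one_le _
  | succ n hn ih =>
    have h := PR_step n (by omega)
    have hx := PR_pos (n + 1)
    set r := √((n : ℝ) + 1) with hr
    have hrp : 0 < r := Real.sqrt_pos.2 (by positivity)
    have hr2 : r ^ 2 = (n : ℝ) + 1 := Real.sq_sqrt (by positivity)
    have h1 : Real.exp (1 / r) * PR n ≤ PR (n + 1) := by
      have := mul_le_mul_of_nonneg_left h (Real.exp_pos (1 / r)).le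
      rw [← mul_assoc, ← Real.exp_add] at this
      simpa using this
    refine le_trans ?_ h1
    refine le_trans ?_ (mul_le_mul_of_nonneg_left ih (Real.exp_pos _).le)
    rw [← Real.exp_add]
    apply Real.exp_le_exp.2
    have : √(((n + 1 : ℕ) : ℝ) + 1) ≤ r + 1 / (2 * r) := by
      apply Real.sqrt_le_iff.2
      constructor
      · positivity
      · have : (r + 1 / (2 * r)) ^ 2 = r ^ 2 + 1 + (1 / (2 * r)) ^ 2 := by field_simp; ring
        rw [this, hr2]
        push_cast
        have := sq_nonneg (1 / (2 * r))
        linarith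
    have e : 2 * (1 / (2 * r)) = 1 / r := by field_simp
    linarith

lemma SR_growth (m n : ℕ) (hm : 1600 ≤ m) (hmn : m ≤ n) :
    SR n ≤ SR m * Real.exp ((18 / 5) * (√(n : ℝ) - √(m : ℝ))) := by
  induction n, hmn using Nat.le_induction with
  | base => simp
  | succ n hn ih =>
    have h := ratio_PS n (by omega)
    have hs := SR_pos n
    rw [SR_succ]
    have hcast : ((n + 1 : ℕ) : ℝ) = (n : ℝ) + 1 := by push_cast; ring
    rw [hcast]
    set r := √((n : ℝ) + 1) with hr
    have hrp : 0 < r := Real.sqrt_pos.2 (by positivity)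
    have hr2 : r ^ 2 = (n : ℝ) + 1 := Real.sq_sqrt (by positivity)
    set q := √(n : ℝ) with hq
    have hqp : 0 ≤ q := Real.sqrt_nonneg _
    have hq2 : q ^ 2 = (n : ℝ) := Real.sq_sqrt (by positivity)
    have hqr : q ≤ r := Real.sqrt_le_sqrt (by linarith)
    have h1 : 1 / r ≤ 2 * (r - q) := by
      rw [div_le_iff₀ hrp]
      nlinarith
    have h2 : PR (n + 1) ≤ (9 / 5) * (1 / r) * SR n := by
      have : PR (n + 1) = (PR (n + 1) * r) * (1 / r) := by field_simp
      rw [this]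
      have := mul_le_mul_of_nonneg_right h (show 0 ≤ 1 / r by positivity)
      linarith
    have h3 : SR n + PR (n + 1) ≤ Real.exp ((18 / 5) * (r - q)) * SR n := by
      have := Real.add_one_le_exp ((18 / 5) * (r - q))
      nlinarith
    refine h3.trans ((mul_le_mul_of_nonneg_left ih (Real.exp_pos _).le).trans (le_of_eq ?_))
    rw [mul_left_comm, ← Real.exp_add]
    congr 2
    ring


/-! ### Second inequality -/

lemma gauss_sum_le (b : ℝ) (hb : 0 < b) (N : ℕ) :
    ∑ i ∈ Finset.range N, Real.exp (-b * ((i : ℝ) + 1) ^ 2) ≤ √(π / b) / 2 := by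
  have hanti : AntitoneOn (fun x : ℝ => Real.exp (-b * x ^ 2)) (Set.Icc (0 : ℝ) (0 + (N : ℕ))) := by
    intro x hx y hy hxy
    apply Real.exp_le_exp.2
    have h0 := hx.1
    have : x ^ 2 ≤ y ^ 2 := by nlinarith
    nlinarith
  have h := hanti.sum_le_integral
  rw [← integral_gaussian_Ioi b]
  have h2 : ∑ i ∈ Finset.range N, Real.exp (-b * ((i : ℝ) + 1) ^ 2) =
      ∑ i ∈ Finset.range N, Real.exp (-b * (0 + ((i + 1 : ℕ) : ℝ)) ^ 2) := by
    apply Finset.sum_congr rfl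
    intro i _
    push_cast
    rw [zero_add]
  rw [h2]
  refine h.trans ?_
  rw [intervalIntegral.integral_of_le (by positivity)]
  apply MeasureTheory.setIntegral_mono_set
  · exact (integrable_exp_neg_mul_sq hb).integrableOn
  · exact Eventually.of_forall (fun x => (Real.exp_pos _).le)
  · exact (Set.Ioc_subset_Ioi_self).eventuallyLE

lemma tt_upper (n : ℕ) (hn : 0 < n) : (tt (n + 1) : ℝ) ≤
    PR n * (4 + Real.exp (1601 / √(n : ℝ)) * (√(π / (1 / (2 * √(n : ℝ)))) / 2)) := by
  have hnr : (0 : ℝ) < √(n : ℝ) := Real.sqrt_pos.2 (by exact_mod_cast hn)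
  have hg := gauss_sum_le (1 / (2 * √(n : ℝ))) (by positivity) (n + 1)
  have h4 := PR_succ_le n
  have hterm : ∀ s ∈ Finset.range (n + 1),
      (((if (s+1)*(s+1+1)/2 ≤ n + 1 then overpartition (n + 1 - (s+1)*(s+1+1)/2) else 0 : ℕ)) : ℝ) ≤
      PR n * Real.exp (1601 / √(n : ℝ)) * Real.exp (-(1 / (2 * √(n : ℝ))) * ((s : ℝ) + 1) ^ 2) := by
    intro s _
    split_ifs with h
    · obtain ⟨t, ht⟩ : ∃ t, (s+1)*(s+1+1)/2 = t + 1 := by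
        refine ⟨(s+1)*(s+1+1)/2 - 1, ?_⟩
        have : 1 ≤ (s+1)*(s+1+1)/2 := by
          rw [Nat.le_div_iff_mul_le (by norm_num)]; nlinarith
        omega
      have ht2 : (s+1)*(s+1+1) = 2 * (t + 1) := by
        have := Nat.even_mul_succ_self (s + 1)
        rw [← ht, Nat.mul_div_cancel' this.two_dvd]
      rw [ht] at h ⊢
      have e : n + 1 - (t + 1) = n - t := by omega
      rw [e]
      have hd := PR_decay n t (by omega)
      change PR (n - t) ≤ _
      refine hd.trans ?_
      rw [mul_comm, mul_assoc, ← Real.exp_add]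
      refine mul_le_mul_of_nonneg_left (Real.exp_le_exp.2 ?_) (PR_pos n).le
      have ht3 : ((s : ℝ) + 1) * (s + 1 + 1) = 2 * (t + 1) := by exact_mod_cast ht2
      have e2 : 1601 / √(n : ℝ) + -(1 / (2 * √(n : ℝ))) * ((s : ℝ) + 1) ^ 2 =
        (1601 - ((s : ℝ) + 1) ^ 2 / 2) / √(n : ℝ) := by field_simp; ring
      rw [e2]
      apply div_le_div_of_nonneg_right _ hnr.le
      have : (0 : ℝ) ≤ s := by positivity
      nlinarith
    · have := PR_pos n
      push_cast
      positivity
  have hsum := Finset.sum_le_sum hterm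
  rw [← Finset.mul_sum] at hsum
  rw [tt, Finset.sum_range_succ']
  push_cast at hsum ⊢
  have h0 : (overpartition (n + 1) : ℝ) = PR (n + 1) := rfl
  simp only [h0]
  have h5 := mul_le_mul_of_nonneg_left hg (mul_pos (PR_pos n) (Real.exp_pos (1601 / √(n : ℝ)))).le
  linarith

lemma v_upper (a : ℤ) (c n : ℕ) (hn : 100000000 ≤ n) :
    (oddBalancedCountMod a c n : ℝ) < √(√(n : ℝ)) * PR n := by
  have hn0 : 0 < n := lt_of_lt_of_le (by norm_num) hn
  have hnr : (100000000 : ℝ) ≤ n := by exact_mod_cast hn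
  have h1 := tt_upper n hn0
  have h2 : (2 : ℝ) * oddBalancedCountMod a c n ≤ tt (n + 1) := by exact_mod_cast upper_bound a c n
  clear hn
  have hs : (10000 : ℝ) ≤ √(n : ℝ) := Real.le_sqrt_of_sq_le (by linarith)
  have hx : (100 : ℝ) ≤ √(√(n : ℝ)) := Real.le_sqrt_of_sq_le (by linarith)
  set q := √(n : ℝ)
  set x := √q with hxdef
  have hx2 : x ^ 2 = q := Real.sq_sqrt (by linarith)
  have hp := PR_pos n
  have he : Real.exp (1601 / q) ≤ 5 / 4 := by
    have h3 : 1601 / q ≤ 1 / 5 := by rw [div_le_iff₀ (by linarith)]; linarith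
    have h4 := Real.exp_le_exp.2 h3
    have h5 : Real.exp (1 / 5) ≤ 1 / (1 - 1 / 5) := Real.exp_bound_div_one_sub_of_interval (by norm_num) (by norm_num)
    have h6 : (1 : ℝ) / (1 - 1 / 5) = 5 / 4 := by norm_num
    linarith
  have hr : √(π / (1 / (2 * q))) / 2 ≤ 13 / 10 * x := by
    have e : π / (1 / (2 * q)) = 2 * π * q := by field_simp
    rw [e, ← hx2]
    have : √(2 * π * x ^ 2) ≤ 13 / 5 * x := by
      apply Real.sqrt_le_iff.2
      constructor
      · positivity
      · have := Real.pi_lt_d2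
        nlinarith [sq_nonneg x]
    linarith
  have hr0 : 0 ≤ √(π / (1 / (2 * q))) / 2 := by positivity
  have h6 : Real.exp (1601 / q) * (√(π / (1 / (2 * q))) / 2) ≤ 5 / 4 * (13 / 10 * x) :=
    mul_le_mul he hr hr0 (by norm_num)
  have h7 : PR n * (4 + Real.exp (1601 / q) * (√(π / (1 / (2 * q))) / 2)) < PR n * (2 * x) := by
    apply mul_lt_mul_of_pos_left _ hp
    linarith
  linarith

lemma second_ineq (a : ℤ) (c n : ℕ) (hn : 100000001 ≤ n) :
    ((oddBalancedCountMod a c (n - 1) * oddBalancedCountMod a c (n + 1) : ℕ) : ℝ) <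
        Real.sqrt n * (overpartition (n - 1) : ℝ) * (overpartition (n + 1) : ℝ) := by
  have h1 := v_upper a c (n - 1) (by omega)
  have h2 := v_upper a c (n + 1) (by omega)
  have hn1 : 1 ≤ n := by omega
  clear hn
  have hx : √√((n - 1 : ℕ) : ℝ) * √√((n + 1 : ℕ) : ℝ) ≤ √(n : ℝ) := by
    rw [← Real.sqrt_mul (Real.sqrt_nonneg _)]
    apply Real.sqrt_le_sqrt
    rw [← Real.sqrt_mul (by positivity)]
    apply Real.sqrt_le_iff.2
    refine ⟨by positivity, ?_⟩
    rw [Nat.cast_sub hn1]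
    push_cast
    nlinarith
  have p1 := PR_pos (n - 1)
  have p2 := PR_pos (n + 1)
  push_cast
  change _ < √(n : ℝ) * PR (n - 1) * PR (n + 1)
  have h3 := mul_lt_mul'' h1 h2 (Nat.cast_nonneg _) (Nat.cast_nonneg _)
  refine h3.trans_le ?_
  have := mul_le_mul_of_nonneg_right hx (mul_pos p1 p2).le
  calc _ = √√((n - 1 : ℕ) : ℝ) * √√((n + 1 : ℕ) : ℝ) * (PR (n - 1) * PR (n + 1)) := by ring
    _ ≤ √(n : ℝ) * (PR (n - 1) * PR (n + 1)) := this
    _ = _ := by ring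


/-! ### First inequality -/

lemma ev_small (K : ℝ) (hK : 0 ≤ K) :
    ∀ᶠ n : ℕ in atTop, K * ((n : ℝ) + 1) ^ 2 * Real.exp (-(√(n : ℝ) / 40)) ≤ 1 := by
  have h1 := Real.tendsto_pow_mul_exp_neg_atTop_nhds_zero 4
  have h2 : Tendsto (fun n : ℕ => √(n : ℝ) / 40) atTop atTop :=
    (Real.tendsto_sqrt_atTop.comp tendsto_natCast_atTop_atTop).atTop_div_const (by norm_num)
  have h3 := ((h1.comp h2).const_mul (K * 4 * 40 ^ 4)).eventually_le_const (u := 1) (by simp)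
  filter_upwards [h3, eventually_ge_atTop 1] with n hn hn1
  refine le_trans ?_ hn
  have hn1' : (1 : ℝ) ≤ n := by exact_mod_cast hn1
  simp only [Function.comp]
  have hy : √(n : ℝ) ^ 2 = n := Real.sq_sqrt (by linarith)
  have e : (√(n : ℝ) / 40) ^ 4 = (n : ℝ) ^ 2 / 40 ^ 4 := by
    rw [div_pow, show √(n : ℝ) ^ 4 = (√(n : ℝ) ^ 2) ^ 2 by ring, hy]
  rw [e]
  have h5 : K * ((n : ℝ) + 1) ^ 2 ≤ K * 4 * (n : ℝ) ^ 2 := by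
    have : ((n : ℝ) + 1) ^ 2 ≤ 4 * (n : ℝ) ^ 2 := by nlinarith
    nlinarith
  calc K * ((n : ℝ) + 1) ^ 2 * Real.exp (-(√(n : ℝ) / 40)) ≤ K * 4 * (n : ℝ) ^ 2 * Real.exp (-(√(n : ℝ) / 40)) :=
        mul_le_mul_of_nonneg_right h5 (Real.exp_pos _).le
    _ = _ := by ring

lemma v_lower (a : ℤ) (c N k m : ℕ) (n : ℝ) (hc : 0 < c) (hk : c ≤ k) (hN : m + k + c ^ 2 ≤ N)
    (hkm : k ≤ m) (hm1 : 1 ≤ m) (hmn : (m : ℝ) ≤ n) (hkn : n / 40 ≤ (k : ℝ) - 1600)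
    (hsmall : 6 * (n + 1) ^ 2 * Real.exp (-(√n / 40)) ≤ 1) :
    PR m ≤ 2 ^ (c + 1) * (oddBalancedCountMod a c N : ℝ) := by
  have h := lower_bound a c N k m hc hk hN
  have h1 : PR m ≤ 2 ^ c * (oddBalancedCountMod a c N : ℝ) + 3 * ((m : ℝ) + 1) ^ 2 * PR (m - k) := by
    rw [PR, PR]; exact_mod_cast h
  have h2 := PR_decay m k hkm
  have hm0 : (1 : ℝ) ≤ m := by exact_mod_cast hm1
  have hsm : 0 < √(m : ℝ) := Real.sqrt_pos.2 (by linarith)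
  have hsn : √(m : ℝ) ≤ √n := Real.sqrt_le_sqrt hmn
  have hn2 : √n ^ 2 = n := Real.sq_sqrt (by linarith)
  have he : (1600 - (k : ℝ)) / √(m : ℝ) ≤ -(√n / 40) := by
    rw [div_le_iff₀ hsm]
    nlinarith
  have h3 : PR (m - k) ≤ Real.exp (-(√n / 40)) * PR m :=
    h2.trans (mul_le_mul_of_nonneg_right (Real.exp_le_exp.2 he) (PR_pos m).le)
  have hp := PR_pos m
  have hE := Real.exp_pos (-(√n / 40))
  have h4 : 3 * ((m : ℝ) + 1) ^ 2 * PR (m - k) ≤ 3 * (n + 1) ^ 2 * (Real.exp (-(√n / 40)) * PR m) := by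
    apply mul_le_mul _ h3 (PR_pos _).le (by positivity)
    have : ((m : ℝ) + 1) ^ 2 ≤ (n + 1) ^ 2 := pow_le_pow_left₀ (by linarith) (by linarith) 2
    linarith
  have h5 := mul_le_mul_of_nonneg_right hsmall hp.le
  rw [pow_succ]
  nlinarith

lemma v_double (a : ℤ) (c n m : ℕ) (hm : 1600 ≤ m) (hmn : m ≤ n) :
    (oddBalancedCountMod a c (2 * n) : ℝ) ≤
      ((n : ℝ) + 1) ^ 2 * PR m * Real.exp ((18 / 5) * (√((2 * n + 1 : ℕ) : ℝ) - √(m : ℝ))) := by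
  have h1 : (2 : ℝ) * oddBalancedCountMod a c (2 * n) ≤ tt (2 * n + 1) := by exact_mod_cast upper_bound a c (2 * n)
  have h2 : (tt (2 * n + 1) : ℝ) ≤ (2 * n + 1 + 1) * PR (2 * n + 1) := by
    rw [PR]; exact_mod_cast tt_le (2 * n + 1)
  have h3 := PR_le_SR (2 * n + 1)
  have h4 := SR_growth m (2 * n + 1) hm (by omega)
  have h5 := SR_le m
  have hmn' : (m : ℝ) ≤ n := by exact_mod_cast hmn
  have hE := Real.exp_pos ((18 / 5) * (√((2 * n + 1 : ℕ) : ℝ) - √(m : ℝ)))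
  set E := Real.exp ((18 / 5) * (√((2 * n + 1 : ℕ) : ℝ) - √(m : ℝ)))
  have hp := PR_pos m
  have h6 : SR m ≤ (n + 1) * PR m := by nlinarith
  have h7 : SR m * E ≤ (n + 1) * PR m * E := mul_le_mul_of_nonneg_right h6 hE.le
  have h8 : PR (2 * n + 1) ≤ (n + 1) * PR m * E := by linarith
  have hn0 : (0 : ℝ) ≤ n := Nat.cast_nonneg _
  have h9 : (oddBalancedCountMod a c (2 * n) : ℝ) ≤ (n + 1) * PR (2 * n + 1) := by linarith
  refine h9.trans ((mul_le_mul_of_nonneg_left h8 (by linarith)).trans (le_of_eq (by ring)))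

lemma exp_compare (n m : ℕ) (hn : 100 ≤ n) (hm : (9 / 10 : ℝ) * n ≤ m) :
    (18 / 5) * (√((2 * n + 1 : ℕ) : ℝ) - √(m : ℝ)) ≤ 2 * √((m : ℝ) + 1) + -(√(n : ℝ) / 40) := by
  have hn' : (100 : ℝ) ≤ n := by exact_mod_cast hn
  have hy : √(n : ℝ) ^ 2 = n := Real.sq_sqrt (by linarith)
  have hy0 : 0 ≤ √(n : ℝ) := Real.sqrt_nonneg _
  have h1 : √((2 * n + 1 : ℕ) : ℝ) ≤ 71 / 50 * √(n : ℝ) := by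
    apply Real.sqrt_le_iff.2
    refine ⟨by positivity, ?_⟩
    rw [mul_pow, hy]
    push_cast
    linarith
  have h2 : 237 / 250 * √(n : ℝ) ≤ √(m : ℝ) := by
    apply Real.le_sqrt_of_sq_le
    rw [mul_pow, hy]
    linarith
  have h3 : √(m : ℝ) ≤ √((m : ℝ) + 1) := Real.sqrt_le_sqrt (by linarith)
  linarith

lemma first_ineq (a : ℤ) (c : ℕ) (hc : 0 < c) : ∀ᶠ n : ℕ in atTop,
    oddBalancedCountMod a c (2 * n) ≤ oddBalancedCountMod a c (n - 1) * oddBalancedCountMod a c (n + 1) := by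
  filter_upwards [ev_small 6 (by norm_num), ev_small (4 ^ (c + 1) * Real.exp (2 * √1601)) (by positivity),
    eventually_ge_atTop (100000 + 40 * c + 40 * c ^ 2)] with n hs1 hs2 hn
  obtain ⟨k, hk⟩ : ∃ k, k = n / 20 := ⟨_, rfl⟩
  obtain ⟨m, hm⟩ : ∃ m, m = n - 1 - k - c ^ 2 := ⟨_, rfl⟩
  have hk1 : c ≤ k := by omega
  have hm1 : 1600 ≤ m := by omega
  have hkm : k ≤ m := by omega
  have hmn : m ≤ n := by omega
  have hN1 : m + k + c ^ 2 ≤ n - 1 := by omega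
  have hN2 : m + k + c ^ 2 ≤ n + 1 := by omega
  have hm9 : 9 * n ≤ 10 * m := by omega
  have hk40 : n + 64000 ≤ 40 * k := by omega
  have hn100 : 100 ≤ n := by omega
  have hm1' : 1 ≤ m := by omega
  have gr := PR_growth m hm1
  have hd := v_double a c n m hm1 hmn
  clear hn hm1 hk hm
  have hmn' : (m : ℝ) ≤ n := by exact_mod_cast hmn
  have hk40' : (n : ℝ) / 40 ≤ (k : ℝ) - 1600 := by
    have : ((n : ℝ) + 64000) ≤ 40 * k := by exact_mod_cast hk40
    linarith
  have hm9' : (9 / 10 : ℝ) * n ≤ m := by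
    have : (9 * n : ℝ) ≤ 10 * m := by exact_mod_cast hm9
    linarith
  have l1 := v_lower a c (n - 1) k m n hc hk1 hN1 hkm hm1' hmn' hk40' hs1
  have l2 := v_lower a c (n + 1) k m n hc hk1 hN2 hkm hm1' hmn' hk40' hs1
  have hec := Real.exp_le_exp.2 (exp_compare n m hn100 hm9')
  rw [Real.exp_add] at hec
  rw [Real.exp_sub, div_le_iff₀ (Real.exp_pos _)] at gr
  have hp := PR_pos m
  set E1 := Real.exp ((18 / 5) * (√((2 * n + 1 : ℕ) : ℝ) - √(m : ℝ)))
  set E2 := Real.exp (2 * √((m : ℝ) + 1))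
  set E3 := Real.exp (-(√(n : ℝ) / 40)) with hE3
  set E4 := Real.exp (2 * √1601)
  have hE3p : 0 < E3 := Real.exp_pos _
  have l3 : PR m * PR m ≤ 4 ^ (c + 1) *
      ((oddBalancedCountMod a c (n - 1) : ℝ) * (oddBalancedCountMod a c (n + 1) : ℝ)) := by
    refine (mul_le_mul l1 l2 hp.le (by positivity)).trans (le_of_eq ?_)
    have : (4 : ℝ) ^ (c + 1) = 2 ^ (c + 1) * 2 ^ (c + 1) := by
      rw [← mul_pow]; norm_num
    rw [this]; ring
  have l4 : 4 ^ (c + 1) * (oddBalancedCountMod a c (2 * n) : ℝ) ≤ PR m * PR m := by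
    calc 4 ^ (c + 1) * (oddBalancedCountMod a c (2 * n) : ℝ)
        ≤ 4 ^ (c + 1) * (((n : ℝ) + 1) ^ 2 * PR m * E1) := mul_le_mul_of_nonneg_left hd (by positivity)
      _ ≤ 4 ^ (c + 1) * (((n : ℝ) + 1) ^ 2 * PR m * (PR m * E4 * E3)) := by
          have : E1 ≤ PR m * E4 * E3 := hec.trans (mul_le_mul_of_nonneg_right gr hE3p.le)
          have h0 : 0 ≤ ((n : ℝ) + 1) ^ 2 * PR m := by positivity
          exact mul_le_mul_of_nonneg_left (mul_le_mul_of_nonneg_left this h0) (by positivity)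
      _ = (4 ^ (c + 1) * E4 * ((n : ℝ) + 1) ^ 2 * E3) * (PR m * PR m) := by ring
      _ ≤ 1 * (PR m * PR m) := mul_le_mul_of_nonneg_right hs2 (by positivity)
      _ = _ := one_mul _
  have l5 := le_of_mul_le_mul_left (l4.trans l3) (by positivity)
  exact_mod_cast l5

/-- Corollary 1.3: for odd `c > 1` there is `N` such that for all `n > N`,
`v(a,c;2n) ≤ v(a,c;n-1)·v(a,c;n+1) < √n · p̄(n-1)·p̄(n+1)`. -/
theorem oddBalancedCountMod_logConcave (a : ℤ) (c : ℕ) (hc : 1 < c) (hcodd : Odd c) :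
    ∃ N : ℕ, ∀ n : ℕ, N < n →
      oddBalancedCountMod a c (2 * n) ≤
        oddBalancedCountMod a c (n - 1) * oddBalancedCountMod a c (n + 1) ∧
      ((oddBalancedCountMod a c (n - 1) * oddBalancedCountMod a c (n + 1) : ℕ) : ℝ) <
        Real.sqrt n * (overpartition (n - 1) : ℝ) * (overpartition (n + 1) : ℝ) := by
  obtain ⟨N, hN⟩ := eventually_atTop.1 (first_ineq a c (by omega))
  refine ⟨max N 100000001, fun n hn => ⟨hN n ((le_max_left _ _).trans hn.le), second_ineq a c n ((le_max_right _ _).trans hn.le)⟩⟩
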